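/- arXiv:1511.07697 — 2 statements merged into one kernel-verified Lean document; each statement's English description precedes it below -/
import Mathlib

section
/- Let I ⊆ Π be μ-connected and F = F_I. Then {w ∈ W : wη = η for all η ∈ F} = W_{I_*} and {w ∈ W : wF = F} = W_{I ∪ I_*}; moreover W_{I ∪ I_*} is the internal direct product of W_I and W_{I_*}: every element of W_I commutes with every element of W_{I_*}, W_I ∩ W_{I_*} = {1}, and every element of W_{I ∪ I_*} is a product of an element of W_I and an element of W_{I_*}. -/
open Set Module

noncomputable section

/-- The linear reflection `x ↦ x - f x • a` associated to a vector `a` and a linear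
functional `f` with `f a = 2`, bundled as a linear automorphism. -/
def reflEquiv {V : Type*} [AddCommGroup V] [Module ℝ V]
    (a : V) (f : V →ₗ[ℝ] ℝ) (h2 : f a = 2) : V ≃ₗ[ℝ] V :=
  LinearEquiv.ofInvolutive (LinearMap.id - f.smulRight a)
    (fun x => by
      simp only [LinearMap.sub_apply, LinearMap.id_apply, LinearMap.smulRight_apply,
        map_sub, map_smul, smul_eq_mul, h2]
      module)

/-- A realization over `ℝ` of an `m × m` generalized Cartan matrix `A`:
simple roots `α_i`, simple coroots `α_i∨` (as linear functionals), with
`⟨α_j, α_i∨⟩ = a_{ij}`, together with the defining axioms. -/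
structure GCMRealization (m : ℕ) (V : Type*) [NormedAddCommGroup V] [NormedSpace ℝ V] where
  A : Matrix (Fin m) (Fin m) ℤ
  root : Fin m → V
  coroot : Fin m → V →ₗ[ℝ] ℝ
  one_le_m : 1 ≤ m
  A_diag : ∀ i, A i i = 2
  A_offdiag : ∀ i j, i ≠ j → A i j ≤ 0
  A_zero_iff : ∀ i j, A i j = 0 ↔ A j i = 0
  root_indep : LinearIndependent ℝ root
  coroot_indep : LinearIndependent ℝ coroot
  pairing : ∀ i j, coroot i (root j) = (A i j : ℝ)
  finDim : FiniteDimensional ℝ V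
  dim_eq : finrank ℝ V + (A.map ((↑) : ℤ → ℝ)).rank = 2 * m

/-- A face of a convex set `H`: a convex subset `F ⊆ H` such that whenever the open
segment between two points of `H` meets `F`, both points lie in `F`. -/
def IsFaceOf {V : Type*} [NormedAddCommGroup V] [NormedSpace ℝ V] (H F : Set V) : Prop :=
  Convex ℝ F ∧ IsExtreme ℝ H F

namespace GCMRealization

variable {m : ℕ} {V : Type*} [NormedAddCommGroup V] [NormedSpace ℝ V]
variable (S : GCMRealization m V)

/-- The fundamental reflection `r_i`. -/
def s (i : Fin m) : V ≃ₗ[ℝ] V :=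
  reflEquiv (S.root i) (S.coroot i) (by
    have h := S.pairing i i
    rw [S.A_diag i] at h
    simpa using h)

/-- The Weyl group `W`, as a subgroup of the group of linear automorphisms of `V`. -/
def W : Subgroup (V ≃ₗ[ℝ] V) := Subgroup.closure (Set.range S.s)

/-- The standard parabolic subgroup `W_I` generated by the reflections indexed by `I`. -/
def WI (I : Set (Fin m)) : Subgroup (V ≃ₗ[ℝ] V) := Subgroup.closure (S.s '' I)

/-- The closed fundamental chamber `C̄`. -/
def chamber : Set V := {η | ∀ i, 0 ≤ S.coroot i η}

/-- `J₀`: the set of indices `i` with `⟨μ, α_i∨⟩ = 0`. -/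
def J0 (μ : V) : Set (Fin m) := {i | S.coroot i μ = 0}

/-- The orbit of `μ` under a subgroup of linear automorphisms. -/
def orbitOf (G : Subgroup (V ≃ₗ[ℝ] V)) (μ : V) : Set V :=
  (fun w : V ≃ₗ[ℝ] V => w μ) '' (G : Set (V ≃ₗ[ℝ] V))

/-- `F_I`: the convex hull of `W_I · μ`. -/
def face (μ : V) (I : Set (Fin m)) : Set V := convexHull ℝ (orbitOf (S.WI I) μ)

/-- `H`: the convex hull of the Weyl group orbit of `μ`. -/
def orbitHull (μ : V) : Set V := convexHull ℝ (orbitOf S.W μ)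

/-- `ℝ₊I`: the set of nonnegative linear combinations of the simple roots indexed by `I`. -/
def coneNonneg (I : Set (Fin m)) : Set V :=
  {v | ∃ c : Fin m → ℝ, (∀ i, 0 ≤ c i) ∧ (∀ i, i ∉ I → c i = 0) ∧ v = ∑ i, c i • S.root i}

/-- `ℝ_>I`: the set of strictly positive linear combinations of the simple roots indexed
by `I` (with `ℝ_>∅ = {0}`). -/
def conePos (I : Set (Fin m)) : Set V :=
  {v | ∃ c : Fin m → ℝ, (∀ i ∈ I, 0 < c i) ∧ (∀ i, i ∉ I → c i = 0) ∧ v = ∑ i, c i • S.root i}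

/-- The open standard facet `C_J`. -/
def openFacet (J : Set (Fin m)) : Set V :=
  {η | (∀ i ∈ J, S.coroot i η = 0) ∧ ∀ i, i ∉ J → 0 < S.coroot i η}

/-- The closed standard facet `C̄_J`. -/
def closedFacet (J : Set (Fin m)) : Set V :=
  {η | (∀ i ∈ J, S.coroot i η = 0) ∧ ∀ i, i ∉ J → 0 ≤ S.coroot i η}

/-- Adjacency of two vertices of the Dynkin diagram: `i ≠ j` and `a_{ij} ≠ 0`
(equivalently `a_{ji} ≠ 0`). -/
def Adjacent (i j : Fin m) : Prop := i ≠ j ∧ S.A i j ≠ 0 ∧ S.A j i ≠ 0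

/-- The Dynkin diagram, as a simple graph on the index set. -/
def diagram : SimpleGraph (Fin m) where
  Adj := S.Adjacent
  symm := ⟨fun _ _ h => ⟨h.1.symm, h.2.2, h.2.1⟩⟩
  loopless := ⟨fun _ h => h.1 rfl⟩

/-- A subset `I` is `μ`-connected if every connected component of `I` meets
`J_> = Π \ J₀` (the empty set is `μ`-connected). -/
def MuConnected (μ : V) (I : Set (Fin m)) : Prop :=
  ∀ i : I, ∃ j : I, S.coroot (j : Fin m) μ ≠ 0 ∧ (S.diagram.induce I).Reachable i j

/-- The connected component of `i` inside `K`, as a subset of the index set. -/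
def comp (K : Set (Fin m)) (i : Fin m) : Set (Fin m) :=
  {j | ∃ (hi : i ∈ K) (hj : j ∈ K), (S.diagram.induce K).Reachable ⟨i, hi⟩ ⟨j, hj⟩}

/-- `I*`: the largest `μ`-connected subset of `I`, i.e. the union of the connected
components of `I` that meet `J_>`. -/
def muPart (μ : V) (I : Set (Fin m)) : Set (Fin m) :=
  {j | ∃ (hj : j ∈ I) (k : Fin m) (hk : k ∈ I), S.coroot k μ ≠ 0 ∧
    (S.diagram.induce I).Reachable ⟨j, hj⟩ ⟨k, hk⟩}

/-- `I_*`: the set of `α ∈ J₀ \ I` orthogonal to all of `I`. -/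
def starSet (μ : V) (I : Set (Fin m)) : Set (Fin m) :=
  {i | S.coroot i μ = 0 ∧ i ∉ I ∧ ∀ j ∈ I, S.coroot i (S.root j) = 0}

/-- A subset `K ⊆ Π` is of finite type if the subgroup `W_K` is finite. -/
def FiniteType (K : Set (Fin m)) : Prop := ((S.WI K : Subgroup (V ≃ₗ[ℝ] V)) : Set (V ≃ₗ[ℝ] V)).Finite

/-- Every connected component of `K` is of finite type. -/
def FinTypeComponents (K : Set (Fin m)) : Prop := ∀ i ∈ K, S.FiniteType (S.comp K i)

/-- A fundamental face of `H`: a face which is empty or whose relative interior meets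
the fundamental chamber. -/
def IsFundFace (μ : V) (F : Set V) : Prop :=
  IsFaceOf (S.orbitHull μ) F ∧ (F = ∅ ∨ (intrinsicInterior ℝ F ∩ S.chamber).Nonempty)

/-- The length of `w ∈ W` with respect to the fundamental reflections. -/
def len (w : V ≃ₗ[ℝ] V) : ℕ :=
  sInf {k | ∃ l : List (Fin m), l.length = k ∧ w = (l.map S.s).prod}

end GCMRealization

end

open Set Module

namespace GCMRealization

section Aux

variable {m : ℕ} {V : Type*} [NormedAddCommGroup V] [NormedSpace ℝ V]
variable (S : GCMRealization m V)

lemma s_apply (i : Fin m) (x : V) : S.s i x = x - S.coroot i x • S.root i := by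
  simp [s, reflEquiv, LinearEquiv.ofInvolutive]

lemma coroot_self (i : Fin m) : S.coroot i (S.root i) = 2 := by
  rw [S.pairing, S.A_diag]; norm_num

lemma s_mul_s (i : Fin m) : S.s i * S.s i = 1 := by
  ext x
  simp only [LinearEquiv.mul_apply, s_apply, map_sub, map_smul, coroot_self, smul_eq_mul]
  simp only [LinearEquiv.coe_one, id]
  module

lemma s_inv (i : Fin m) : (S.s i)⁻¹ = S.s i :=
  inv_eq_of_mul_eq_one_left (S.s_mul_s i)

lemma s_mul_cancel (i : Fin m) (w : V ≃ₗ[ℝ] V) : w * S.s i * S.s i = w := by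
  rw [mul_assoc, s_mul_s, mul_one]

lemma s_mul_cancel_left (i : Fin m) (w : V ≃ₗ[ℝ] V) : S.s i * (S.s i * w) = w := by
  rw [← mul_assoc, s_mul_s, one_mul]

lemma s_mem {K : Set (Fin m)} {i : Fin m} (hi : i ∈ K) : S.s i ∈ S.WI K :=
  Subgroup.subset_closure ⟨i, hi, rfl⟩

lemma WI_mono {K L : Set (Fin m)} (h : K ⊆ L) : S.WI K ≤ S.WI L :=
  Subgroup.closure_mono (Set.image_mono h)

lemma W_eq : S.W = S.WI univ := by
  simp [W, WI]

/-- `w` is a product of at most `n` reflections from `K`. -/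
def LE (K : Set (Fin m)) (n : ℕ) (w : V ≃ₗ[ℝ] V) : Prop :=
  ∃ l : List (Fin m), (∀ i ∈ l, i ∈ K) ∧ l.length ≤ n ∧ w = (l.map S.s).prod

variable {S}

lemma LE.mul {K : Set (Fin m)} {n k : ℕ} {w v : V ≃ₗ[ℝ] V} (h : S.LE K n w) (h' : S.LE K k v) :
    S.LE K (n + k) (w * v) := by
  obtain ⟨l, h1, h2, rfl⟩ := h
  obtain ⟨l', h1', h2', rfl⟩ := h'
  refine ⟨l ++ l', ?_, ?_, by simp⟩
  · intro i hi
    rcases List.mem_append.1 hi with h | h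
    · exact h1 i h
    · exact h1' i h
  · rw [List.length_append]; omega

lemma LE.mono {K L : Set (Fin m)} {n k : ℕ} {w : V ≃ₗ[ℝ] V} (h : S.LE K n w) (hK : K ⊆ L)
    (hn : n ≤ k) : S.LE L k w := by
  obtain ⟨l, h1, h2, h3⟩ := h
  exact ⟨l, fun i hi => hK (h1 i hi), h2.trans hn, h3⟩

lemma LE_s {K : Set (Fin m)} {i : Fin m} (hi : i ∈ K) : S.LE K 1 (S.s i) :=
  ⟨[i], by simpa using hi, by simp, by simp⟩

lemma LE_one {K : Set (Fin m)} : S.LE K 0 1 := ⟨[], by simp, by simp, by simp⟩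

lemma LE.mem {K : Set (Fin m)} {n : ℕ} {w : V ≃ₗ[ℝ] V} (h : S.LE K n w) : w ∈ S.WI K := by
  obtain ⟨l, h1, h2, rfl⟩ := h
  apply Subgroup.list_prod_mem
  intro x hx
  obtain ⟨i, hi, rfl⟩ := List.mem_map.1 hx
  exact S.s_mem (h1 i hi)

lemma exists_LE {K : Set (Fin m)} {w : V ≃ₗ[ℝ] V} (h : w ∈ S.WI K) : ∃ n, S.LE K n w := by
  induction h using Subgroup.closure_induction_right with
  | one => exact ⟨0, LE_one⟩
  | mul_right x y hy z ih =>
    obtain ⟨i, hi, rfl⟩ := z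
    obtain ⟨n, hn⟩ := ih
    exact ⟨n + 1, hn.mul (LE_s hi)⟩
  | mul_inv_cancel x y hy z ih =>
    obtain ⟨i, hi, rfl⟩ := z
    obtain ⟨n, hn⟩ := ih
    exact ⟨n + 1, by rw [S.s_inv]; exact hn.mul (LE_s hi)⟩

/-- last letter decomposition -/
lemma LE.last {K : Set (Fin m)} {n : ℕ} {w : V ≃ₗ[ℝ] V} (h : S.LE K n w) :
    w = 1 ∨ ∃ k ∈ K, ∃ d, d + 1 ≤ n ∧ ∃ v, S.LE K d v ∧ w = v * S.s k := by
  obtain ⟨l, h1, h2, rfl⟩ := h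
  rcases List.eq_nil_or_concat l with rfl | ⟨l', k, rfl⟩
  · left; simp
  · right
    simp only [List.concat_eq_append, List.length_append, List.length_singleton] at *
    exact ⟨k, h1 k (by simp), l'.length, h2, (l'.map S.s).prod,
      ⟨l', fun i hi => h1 i (by simp [hi]), le_rfl, rfl⟩, by simp⟩

lemma LE.first {K : Set (Fin m)} {n : ℕ} {w : V ≃ₗ[ℝ] V} (h : S.LE K n w) :
    w = 1 ∨ ∃ k ∈ K, ∃ d, d + 1 ≤ n ∧ ∃ v, S.LE K d v ∧ w = S.s k * v := by
  obtain ⟨l, h1, h2, rfl⟩ := h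
  rcases l with _ | ⟨k, l'⟩
  · left; simp
  · right
    simp only [List.length_cons] at *
    exact ⟨k, h1 k (by simp), l'.length, h2, (l'.map S.s).prod,
      ⟨l', fun i hi => h1 i (by simp [hi]), le_rfl, rfl⟩, by simp⟩

/-! cones -/

lemma cone_zero {K : Set (Fin m)} : (0 : V) ∈ S.coneNonneg K :=
  ⟨0, by simp, by simp, by simp⟩

lemma cone_root {K : Set (Fin m)} {i : Fin m} (hi : i ∈ K) : S.root i ∈ S.coneNonneg K := by
  classical
  refine ⟨Pi.single i 1, ?_, ?_, ?_⟩
  · intro j; by_cases h : j = i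
    · subst h; simp
    · simp [h]
  · intro j hj
    have : j ≠ i := by rintro rfl; exact hj hi
    simp [this]
  · simp [Pi.single_apply, ite_smul]

lemma cone_add {K : Set (Fin m)} {x y : V} (hx : x ∈ S.coneNonneg K) (hy : y ∈ S.coneNonneg K) :
    x + y ∈ S.coneNonneg K := by
  obtain ⟨c, h1, h2, rfl⟩ := hx
  obtain ⟨d, h1', h2', rfl⟩ := hy
  refine ⟨c + d, fun i => add_nonneg (h1 i) (h1' i), fun i hi => by simp [h2 i hi, h2' i hi], ?_⟩
  simp [add_smul, Finset.sum_add_distrib]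

lemma cone_smul {K : Set (Fin m)} {x : V} {a : ℝ} (ha : 0 ≤ a) (hx : x ∈ S.coneNonneg K) :
    a • x ∈ S.coneNonneg K := by
  obtain ⟨c, h1, h2, rfl⟩ := hx
  refine ⟨a • c, fun i => mul_nonneg ha (h1 i), fun i hi => by simp [h2 i hi], ?_⟩
  simp [mul_smul, Finset.smul_sum]

lemma cone_mono {K L : Set (Fin m)} (h : K ⊆ L) {x : V} (hx : x ∈ S.coneNonneg K) :
    x ∈ S.coneNonneg L := by
  obtain ⟨c, h1, h2, rfl⟩ := hx
  exact ⟨c, h1, fun i hi => h2 i (fun h' => hi (h h')), rfl⟩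

lemma coef_unique {c d : Fin m → ℝ} (h : ∑ i, c i • S.root i = ∑ i, d i • S.root i) : c = d := by
  have h1 := Fintype.linearIndependent_iff.1 S.root_indep (fun i => c i - d i)
    (by simp [sub_smul, h])
  funext i
  exact sub_eq_zero.1 (h1 i)

lemma cone_add_eq_zero {K L : Set (Fin m)} {x y : V} (hx : x ∈ S.coneNonneg K)
    (hy : y ∈ S.coneNonneg L) (h : x + y = 0) : x = 0 := by
  obtain ⟨c, h1, h2, rfl⟩ := hx
  obtain ⟨d, h1', h2', rfl⟩ := hy
  have : (fun i => c i + d i) = 0 := by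
    apply S.coef_unique
    simpa [add_smul, Finset.sum_add_distrib] using h
  apply Finset.sum_eq_zero
  intro i _
  have h3 := congrFun this i
  simp only [Pi.zero_apply] at h3
  have : c i = 0 := by linarith [h1 i, h1' i]
  simp [this]

/-- image of cone under linear map -/
lemma cone_map {K L : Set (Fin m)} (w : V ≃ₗ[ℝ] V) (hw : ∀ k ∈ K, w (S.root k) ∈ S.coneNonneg L)
    {x : V} (hx : x ∈ S.coneNonneg K) : w x ∈ S.coneNonneg L := by
  obtain ⟨c, h1, h2, rfl⟩ := hx
  rw [map_sum]
  have : ∀ T : Finset (Fin m), ∑ i ∈ T, w (c i • S.root i) ∈ S.coneNonneg L := by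
    intro T
    classical
    induction T using Finset.induction_on with
    | empty => simpa using cone_zero
    | insert i T hi ih =>
      rw [Finset.sum_insert hi]
      refine cone_add ?_ ih
      rw [map_smul]
      by_cases hK : i ∈ K
      · exact cone_smul (h1 i) (hw i hK)
      · simpa [h2 i hK] using cone_zero
  exact this _

lemma span_coef {K : Set (Fin m)} {x : V} (hx : x ∈ Submodule.span ℝ (S.root '' K)) :
    ∃ c : Fin m → ℝ, (∀ i, i ∉ K → c i = 0) ∧ x = ∑ i, c i • S.root i := by
  classical
  induction hx using Submodule.span_induction with
  | mem x h =>
    obtain ⟨i, hi, rfl⟩ := h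
    obtain ⟨c, _, h2, h3⟩ := cone_root (S := S) hi
    exact ⟨c, h2, h3⟩
  | zero => exact ⟨0, by simp, by simp⟩
  | add x y _ _ hx hy =>
    obtain ⟨c, h2, rfl⟩ := hx
    obtain ⟨d, h2', rfl⟩ := hy
    exact ⟨c + d, fun i hi => by simp [h2 i hi, h2' i hi],
      by simp [add_smul, Finset.sum_add_distrib]⟩
  | smul a x _ hx =>
    obtain ⟨c, h2, rfl⟩ := hx
    exact ⟨a • c, fun i hi => by simp [h2 i hi], by simp [mul_smul, Finset.smul_sum]⟩

lemma cone_subset_span {K : Set (Fin m)} {x : V} (hx : x ∈ S.coneNonneg K) :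
    x ∈ Submodule.span ℝ (S.root '' K) := by
  obtain ⟨c, h1, h2, rfl⟩ := hx
  apply Submodule.sum_mem
  intro i _
  by_cases h : i ∈ K
  · exact Submodule.smul_mem _ _ (Submodule.subset_span ⟨i, h, rfl⟩)
  · simp [h2 i h]

lemma cone_inter_span {K L : Set (Fin m)} {x : V} (hx : x ∈ S.coneNonneg K)
    (hx' : x ∈ Submodule.span ℝ (S.root '' L)) : x ∈ S.coneNonneg (K ∩ L) := by
  obtain ⟨c, h1, h2, rfl⟩ := hx
  obtain ⟨d, h3, h4⟩ := span_coef hx'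
  obtain rfl := S.coef_unique h4
  refine ⟨c, h1, fun i hi => ?_, rfl⟩
  by_contra h
  exact hi ⟨by_contra fun h' => h (h2 i h'), by_contra fun h' => h (h3 i h')⟩

/-- `w ∈ W_K` moves each vector by something in the span of `K`. -/
lemma WI_sub_mem {K : Set (Fin m)} {w : V ≃ₗ[ℝ] V} (h : w ∈ S.WI K) (x : V) :
    w x - x ∈ Submodule.span ℝ (S.root '' K) := by
  obtain ⟨n, h⟩ := exists_LE h
  induction n generalizing w x with
  | zero =>
    rcases h.last with rfl | ⟨k, hk, d, hd, _⟩
    · simp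
    · omega
  | succ n ih =>
    rcases h.last with rfl | ⟨k, hk, d, hd, v, hv, rfl⟩
    · simp
    · have h1 := ih (hv.mem) (S.s k x) (hv.mono subset_rfl (by omega))
      have h2 : (v * S.s k) x - x = (v (S.s k x) - S.s k x) - S.coroot k x • S.root k := by
        rw [LinearEquiv.mul_apply, S.s_apply]; abel
      rw [h2]
      exact Submodule.sub_mem _ h1 (Submodule.smul_mem _ _ (Submodule.subset_span ⟨k, hk, rfl⟩))

/-! rank two -/

variable (S) in
/-- alternating word of length `n` ending in `t` -/
def alt (s t : Fin m) : ℕ → (V ≃ₗ[ℝ] V)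
  | 0 => 1
  | n + 1 => (if Even n then S.s t else S.s s) * alt s t n

lemma alt_LE (s t : Fin m) (n : ℕ) : S.LE {s, t} n (S.alt s t n) := by
  induction n with
  | zero => exact LE_one
  | succ n ih =>
    rw [alt, add_comm]
    split_ifs
    · exact (LE_s (by simp)).mul ih
    · exact (LE_s (by simp)).mul ih

/-- Reduction to alternating words. -/
lemma LE_alt {s t : Fin m} {n : ℕ} {u : V ≃ₗ[ℝ] V} (h : S.LE {s, t} n u) :
    (∃ k, k + 1 ≤ n ∧ S.LE {s, t} k (u * S.s s)) ∨ ∃ k, k ≤ n ∧ u = S.alt s t k := by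
  induction n generalizing u with
  | zero =>
    rcases h.first with rfl | ⟨k, hk, d, hd, _⟩
    · right; exact ⟨0, le_rfl, rfl⟩
    · omega
  | succ n ih =>
    rcases h.first with rfl | ⟨x, hx, d, hd, v, hv, rfl⟩
    · right; exact ⟨0, by omega, rfl⟩
    · rcases ih (hv.mono subset_rfl (by omega)) with ⟨k, hk, hk'⟩ | ⟨k, hk, rfl⟩
      · left
        refine ⟨1 + k, by omega, ?_⟩
        rw [mul_assoc]
        exact (LE_s hx).mul hk'
      · rcases k with _ | k
        · rcases hx with rfl | hx
          · left
            refine ⟨0, by omega, ?_⟩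
            simp only [alt, mul_one, s_mul_s]
            exact LE_one
          · right
            rw [mem_singleton_iff] at hx
            subst hx
            exact ⟨1, by omega, by simp [alt]⟩
        · right
          have key : S.s x * S.alt s t (k + 1) = S.alt s t (k + 2) ∨
              S.s x * S.alt s t (k + 1) = S.alt s t k := by
            by_cases hk2 : Even k
            · have hk3 : ¬ Even (k + 1) := by rw [Nat.even_add_one]; simpa using hk2
              rcases hx with rfl | hx
              · left; rw [alt.eq_2 _ _ _ (k+1), if_neg hk3]
              · rw [mem_singleton_iff] at hx
                subst hx
                right; rw [alt, if_pos hk2, s_mul_cancel_left]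
            · have hk3 : Even (k + 1) := by rw [Nat.even_add_one]; simpa using hk2
              rcases hx with rfl | hx
              · right; rw [alt, if_neg hk2, s_mul_cancel_left]
              · rw [mem_singleton_iff] at hx
                subst hx
                left; rw [alt.eq_2 _ _ _ (k+1), if_pos hk3]
          rcases key with h | h
          · exact ⟨k + 2, by omega, h⟩
          · exact ⟨k, by omega, h⟩

lemma cone_pair (s t : Fin m) {p q : ℝ} (hp : 0 ≤ p) (hq : 0 ≤ q) :
    p • S.root s + q • S.root t ∈ S.coneNonneg {s, t} :=
  cone_add (cone_smul hp (cone_root (by simp))) (cone_smul hq (cone_root (by simp)))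

lemma alt_infinite {s t : Fin m} (a b : ℝ) (hst : S.coroot s (S.root t) = -a)
    (hts : S.coroot t (S.root s) = -b) (ha : 0 ≤ a) (hb : 0 ≤ b) (hab : 4 ≤ a * b) (n : ℕ) :
    ∃ p q : ℝ, 0 ≤ p ∧ 0 ≤ q ∧ S.alt s t n (S.root s) = p • S.root s + q • S.root t ∧
      (if Even n then a * q ≤ 2 * p else b * p ≤ 2 * q) := by
  induction n with
  | zero => exact ⟨1, 0, by norm_num, le_rfl, by simp [alt], by simp⟩
  | succ n ih =>
    obtain ⟨p, q, hp, hq, h, h'⟩ := ih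
    by_cases hn : Even n
    · have hn' : ¬ Even (n + 1) := by rw [Nat.even_add_one]; simpa using hn
      rw [if_pos hn] at h'
      have h3 : 2 * q ≤ b * p := by nlinarith
      refine ⟨p, b * p - q, hp, by linarith, ?_, ?_⟩
      · rw [alt, if_pos hn, LinearEquiv.mul_apply, h, s_apply]
        simp only [map_add, map_smul, hts, coroot_self, smul_eq_mul]
        module
      · rw [if_neg hn']; linarith
    · have hn' : Even (n + 1) := by rw [Nat.even_add_one]; simpa using hn
      rw [if_neg hn] at h'
      have h3 : 2 * p ≤ a * q := by nlinarith
      refine ⟨a * q - p, q, by linarith, hq, ?_, ?_⟩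
      · rw [alt, if_neg hn, LinearEquiv.mul_apply, h, s_apply]
        simp only [map_add, map_smul, hst, coroot_self, smul_eq_mul]
        module
      · rw [if_pos hn']; linarith

lemma alt_finite_aux {s t : Fin m} (M : ℕ) (hM : 0 < M)
    (h1 : ∀ n < M, S.alt s t n (S.root s) ∈ S.coneNonneg {s, t})
    (h2 : S.alt s t M = S.alt t s M) (n : ℕ) :
    (∃ k, k + 1 ≤ n ∧ S.LE {s, t} k (S.alt s t n * S.s s)) ∨
      S.alt s t n (S.root s) ∈ S.coneNonneg {s, t} := by
  by_cases hn : n < M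
  · right; exact h1 n hn
  left
  push Not at hn
  have hrev : ∀ n, ∃ v, S.LE {s, t} n v ∧ S.alt t s (n + 1) = v * S.s s := by
    intro n
    induction n with
    | zero => exact ⟨1, LE_one, by simp [alt]⟩
    | succ n ih =>
      obtain ⟨v, hv, h⟩ := ih
      rw [alt, h, ← mul_assoc]
      refine ⟨_, ?_, rfl⟩
      rw [add_comm]
      split_ifs
      · exact (LE_s (by simp)).mul hv
      · exact (LE_s (by simp)).mul hv
  induction n, hn using Nat.le_induction with
  | base =>
    obtain ⟨v, hv, h⟩ := hrev (M - 1)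
    rw [Nat.sub_add_cancel hM] at h
    exact ⟨M - 1, by omega, by rw [h2, h, s_mul_cancel]; exact hv⟩
  | succ n hn ih =>
    obtain ⟨k, hk, hk'⟩ := ih
    refine ⟨1 + k, by omega, ?_⟩
    rw [alt, mul_assoc]
    split_ifs
    · exact (LE_s (by simp)).mul hk'
    · exact (LE_s (by simp)).mul hk'

lemma alt_finite {s t : Fin m} (a b : ℕ) (hst : S.coroot s (S.root t) = -(a : ℝ))
    (hts : S.coroot t (S.root s) = -(b : ℝ)) (hab : a * b ≤ 3) (h0 : a = 0 ↔ b = 0) :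
    ∃ M, 0 < M ∧ (∀ n < M, S.alt s t n (S.root s) ∈ S.coneNonneg {s, t}) ∧
    S.alt s t M = S.alt t s M := by
  have hs := S.coroot_self s
  have ht := S.coroot_self t
  have fin : ∀ n (p q : ℝ), 0 ≤ p → 0 ≤ q → S.alt s t n (S.root s) = p • S.root s + q • S.root t →
      S.alt s t n (S.root s) ∈ S.coneNonneg {s, t} := by
    intro n p q hp hq h; rw [h]; exact cone_pair s t hp hq
  have hcases : (a = 0 ∧ b = 0) ∨ (a = 1 ∧ b = 1) ∨ (a = 1 ∧ b = 2) ∨ (a = 2 ∧ b = 1) ∨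
      (a = 1 ∧ b = 3) ∨ (a = 3 ∧ b = 1) := by
    by_cases ha : a = 0
    · simp [ha, h0.1 ha]
    have hb : b ≠ 0 := fun h => ha (h0.2 h)
    have ha3 : a ≤ 3 := by nlinarith [Nat.pos_of_ne_zero hb]
    have hb3 : b ≤ 3 := by nlinarith [Nat.pos_of_ne_zero ha]
    interval_cases a <;> interval_cases b <;> simp_all
  rcases hcases with ⟨rfl, rfl⟩ | ⟨rfl, rfl⟩ | ⟨rfl, rfl⟩ | ⟨rfl, rfl⟩ | ⟨rfl, rfl⟩ | ⟨rfl, rfl⟩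
  all_goals norm_num at hst hts
  · refine ⟨2, by norm_num, ?_, ?_⟩
    · intro n hn
      interval_cases n
      · refine fin _ 1 0 (by norm_num) (by norm_num) ?_
        simp [alt]
      · refine fin _ 1 0 (by norm_num) (by norm_num) ?_
        simp [alt, s_apply, hts]
    · ext x
      simp [alt, s_apply, hs, ht, hst, hts, Nat.even_add_one]
      try module
  · refine ⟨3, by norm_num, ?_, ?_⟩
    · intro n hn
      interval_cases n
      · refine fin _ 1 0 (by norm_num) (by norm_num) ?_
        simp [alt]
      · refine fin _ 1 1 (by norm_num) (by norm_num) ?_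
        simp [alt, s_apply, hs, ht, hst, hts, Nat.even_add_one]
      · refine fin _ 0 1 (by norm_num) (by norm_num) ?_
        simp [alt, s_apply, hs, ht, hst, hts, Nat.even_add_one]
        try module
    · ext x
      simp [alt, s_apply, hs, ht, hst, hts, Nat.even_add_one]
      try module
  · refine ⟨4, by norm_num, ?_, ?_⟩
    · intro n hn
      interval_cases n
      · refine fin _ 1 0 (by norm_num) (by norm_num) ?_
        simp [alt]
      · refine fin _ 1 2 (by norm_num) (by norm_num) ?_
        simp [alt, s_apply, hs, ht, hst, hts, Nat.even_add_one]
      · refine fin _ 1 2 (by norm_num) (by norm_num) ?_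
        simp [alt, s_apply, hs, ht, hst, hts, Nat.even_add_one]
        try module
      · refine fin _ 1 0 (by norm_num) (by norm_num) ?_
        simp [alt, s_apply, hs, ht, hst, hts, Nat.even_add_one]
        try module
    · ext x
      simp [alt, s_apply, hs, ht, hst, hts, Nat.even_add_one]
      try module
  · refine ⟨4, by norm_num, ?_, ?_⟩
    · intro n hn
      interval_cases n
      · refine fin _ 1 0 (by norm_num) (by norm_num) ?_
        simp [alt]
      · refine fin _ 1 1 (by norm_num) (by norm_num) ?_
        simp [alt, s_apply, hs, ht, hst, hts, Nat.even_add_one]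
      · refine fin _ 1 1 (by norm_num) (by norm_num) ?_
        simp [alt, s_apply, hs, ht, hst, hts, Nat.even_add_one]
        try module
      · refine fin _ 1 0 (by norm_num) (by norm_num) ?_
        simp [alt, s_apply, hs, ht, hst, hts, Nat.even_add_one]
        try module
    · ext x
      simp [alt, s_apply, hs, ht, hst, hts, Nat.even_add_one]
      try module
  · refine ⟨6, by norm_num, ?_, ?_⟩
    · intro n hn
      interval_cases n
      · refine fin _ 1 0 (by norm_num) (by norm_num) ?_
        simp [alt]
      · refine fin _ 1 3 (by norm_num) (by norm_num) ?_
        simp [alt, s_apply, hs, ht, hst, hts, Nat.even_add_one]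
      · refine fin _ 2 3 (by norm_num) (by norm_num) ?_
        simp [alt, s_apply, hs, ht, hst, hts, Nat.even_add_one]
        try module
      · refine fin _ 2 3 (by norm_num) (by norm_num) ?_
        simp [alt, s_apply, hs, ht, hst, hts, Nat.even_add_one]
        try module
      · refine fin _ 1 3 (by norm_num) (by norm_num) ?_
        simp [alt, s_apply, hs, ht, hst, hts, Nat.even_add_one]
        try module
      · refine fin _ 1 0 (by norm_num) (by norm_num) ?_
        simp [alt, s_apply, hs, ht, hst, hts, Nat.even_add_one]
        try module
    · ext x
      simp [alt, s_apply, hs, ht, hst, hts, Nat.even_add_one]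
      try module
  · refine ⟨6, by norm_num, ?_, ?_⟩
    · intro n hn
      interval_cases n
      · refine fin _ 1 0 (by norm_num) (by norm_num) ?_
        simp [alt]
      · refine fin _ 1 1 (by norm_num) (by norm_num) ?_
        simp [alt, s_apply, hs, ht, hst, hts, Nat.even_add_one]
      · refine fin _ 2 1 (by norm_num) (by norm_num) ?_
        simp [alt, s_apply, hs, ht, hst, hts, Nat.even_add_one]
        try module
      · refine fin _ 2 1 (by norm_num) (by norm_num) ?_
        simp [alt, s_apply, hs, ht, hst, hts, Nat.even_add_one]
        try module
      · refine fin _ 1 1 (by norm_num) (by norm_num) ?_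
        simp [alt, s_apply, hs, ht, hst, hts, Nat.even_add_one]
        try module
      · refine fin _ 1 0 (by norm_num) (by norm_num) ?_
        simp [alt, s_apply, hs, ht, hst, hts, Nat.even_add_one]
        try module
    · ext x
      simp [alt, s_apply, hs, ht, hst, hts, Nat.even_add_one]
      try module

lemma rank_two {s t : Fin m} (hne : s ≠ t) {n : ℕ} {u : V ≃ₗ[ℝ] V} (h : S.LE {s, t} n u) :
    (∃ k, k + 1 ≤ n ∧ S.LE {s, t} k (u * S.s s)) ∨ u (S.root s) ∈ S.coneNonneg {s, t} := by
  rcases LE_alt h with h | ⟨k, hk, rfl⟩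
  · exact Or.inl h
  obtain ⟨a, ha⟩ := Int.eq_ofNat_of_zero_le (neg_nonneg.2 (S.A_offdiag s t hne))
  obtain ⟨b, hb⟩ := Int.eq_ofNat_of_zero_le (neg_nonneg.2 (S.A_offdiag t s hne.symm))
  have ha' : S.A s t = -(a : ℤ) := by linarith
  have hb' : S.A t s = -(b : ℤ) := by linarith
  have hst : S.coroot s (S.root t) = -(a : ℝ) := by rw [S.pairing, ha']; simp
  have hts : S.coroot t (S.root s) = -(b : ℝ) := by rw [S.pairing, hb']; simp
  by_cases hab : a * b ≤ 3
  · have h0 : a = 0 ↔ b = 0 := by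
      have := S.A_zero_iff s t
      rw [ha', hb'] at this
      simpa using this
    obtain ⟨M, h1, h2, h3⟩ := alt_finite a b hst hts hab h0
    rcases alt_finite_aux M h1 h2 h3 k with ⟨j, hj, hj'⟩ | h
    · exact Or.inl ⟨j, by omega, hj'⟩
    · exact Or.inr h
  · right
    have hab' : (4 : ℝ) ≤ a * b := by
      have : 4 ≤ a * b := by omega
      exact_mod_cast this
    obtain ⟨p, q, hp, hq, h, _⟩ := alt_infinite (a : ℝ) b hst hts (by positivity) (by positivity)
      hab' k
    rw [h]
    exact cone_pair s t hp hq

/-- The main positivity theorem. -/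
lemma positivity_main {K : Set (Fin m)} (n : ℕ) : ∀ w : V ≃ₗ[ℝ] V, S.LE K n w → ∀ k ∈ K,
    (∃ n', n' + 1 ≤ n ∧ S.LE K n' (w * S.s k)) ∨ w (S.root k) ∈ S.coneNonneg K := by
  induction n using Nat.strong_induction_on with
  | _ n ih =>
  intro w hw s hs
  rcases hw.last with rfl | ⟨t, ht, d0, hd0, v0, hv0, rfl⟩
  · right; simpa using cone_root hs
  by_cases hst : s = t
  · subst hst
    left
    exact ⟨d0, hd0, by rw [s_mul_cancel]; exact hv0⟩
  have hsub : ({s, t} : Set (Fin m)) ⊆ K := by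
    rintro x (rfl | rfl) <;> assumption
  set w := v0 * S.s t with hwdef
  have hex : ∃ d, d < n ∧ ∃ e v u, S.LE K d v ∧ S.LE {s, t} e u ∧ d + e ≤ n ∧ w = v * u :=
    ⟨d0, by omega, 1, v0, S.s t, hv0, LE_s (by simp), hd0, rfl⟩
  classical
  obtain ⟨hd, e, v, u, hv, hu, hde, hvu⟩ := Nat.find_spec hex
  have hmin := fun d (h : d < Nat.find hex) => Nat.find_min hex h
  generalize Nat.find hex = d at *
  have hpos : ∀ x ∈ ({s, t} : Set (Fin m)), v (S.root x) ∈ S.coneNonneg K := by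
    intro x hx
    rcases ih d hd v hv x (hsub hx) with ⟨d', hd', h⟩ | h
    · exfalso
      refine hmin d' (by omega) ⟨by omega, 1 + e, v * S.s x, S.s x * u, h, (LE_s hx).mul hu,
        by omega, ?_⟩
      rw [hvu, mul_assoc, s_mul_cancel_left]
    · exact h
  rcases rank_two hst hu with ⟨e', he', h⟩ | h
  · left
    refine ⟨d + e', by omega, ?_⟩
    rw [hvu, mul_assoc]
    exact hv.mul (h.mono hsub le_rfl)
  · right
    rw [hvu, LinearEquiv.mul_apply]
    exact cone_map v hpos h

lemma stab_main {K : Set (Fin m)} {η : V} (hη : ∀ k ∈ K, 0 ≤ S.coroot k η) (n : ℕ) :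
    ∀ w : V ≃ₗ[ℝ] V, S.LE K n w → η - w η ∈ S.coneNonneg K ∧
      (w η = η → w ∈ S.WI (K ∩ {k | S.coroot k η = 0})) := by
  induction n using Nat.strong_induction_on with
  | _ n ih =>
  intro w hw
  rcases hw.last with rfl | ⟨k, hk, d, hd, v, hv, rfl⟩
  · exact ⟨by simpa using cone_zero, fun _ => one_mem _⟩
  rcases positivity_main d v hv k hk with ⟨n', hn', h⟩ | h
  · exact ih n' (by omega) _ h
  · obtain ⟨h1, h2⟩ := ih d (by omega) v hv
    have e : η - (v * S.s k) η = (η - v η) + S.coroot k η • v (S.root k) := by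
      rw [LinearEquiv.mul_apply, s_apply, map_sub, map_smul]; abel
    have h3 := cone_smul (hη k hk) h
    refine ⟨by rw [e]; exact cone_add h1 h3, fun h4 => ?_⟩
    rw [h4, sub_self] at e
    have h5 := cone_add_eq_zero h1 h3 e.symm
    have h6 := cone_add_eq_zero h3 h1 (by rw [add_comm]; exact e.symm)
    have h7 : S.coroot k η = 0 := by
      rcases smul_eq_zero.1 h6 with h | h
      · exact h
      · exact absurd ((LinearEquiv.map_eq_zero_iff v).1 h) (S.root_indep.ne_zero k)
    exact mul_mem (h2 (sub_eq_zero.1 h5).symm) (S.s_mem ⟨hk, h7⟩)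

lemma dom_sub {K : Set (Fin m)} {η : V} (hη : ∀ k ∈ K, 0 ≤ S.coroot k η) {w : V ≃ₗ[ℝ] V}
    (hw : w ∈ S.WI K) : η - w η ∈ S.coneNonneg K := by
  obtain ⟨n, h⟩ := exists_LE hw
  exact (stab_main hη n w h).1

lemma dom_stab {K : Set (Fin m)} {η : V} (hη : ∀ k ∈ K, 0 ≤ S.coroot k η) {w : V ≃ₗ[ℝ] V}
    (hw : w ∈ S.WI K) (h' : w η = η) : w ∈ S.WI (K ∩ {k | S.coroot k η = 0}) := by
  obtain ⟨n, h⟩ := exists_LE hw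
  exact (stab_main hη n w h).2 h'

lemma neg_root_dom {K : Set (Fin m)} {i : Fin m} (hi : i ∉ K) :
    ∀ k ∈ K, 0 ≤ S.coroot k (-S.root i) := by
  intro k hk
  rw [map_neg, S.pairing]
  have := S.A_offdiag k i (by rintro rfl; exact hi hk)
  have : (S.A k i : ℝ) ≤ 0 := by exact_mod_cast this
  linarith

/-- Core lemma. -/
lemma core {μ : V} {I : Set (Fin m)} (hcon : S.MuConnected μ I) {w : V ≃ₗ[ℝ] V}
    (hw : w ∈ S.WI (S.J0 μ))
    (hfix : ∀ K ⊆ S.J0 μ, w ∈ S.WI K → ∀ i ∈ I, i ∉ K → w (S.root i) = S.root i) :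
    w ∈ S.WI (S.starSet μ I) := by
  obtain ⟨K, ⟨hK1, hK2⟩, hmin⟩ : ∃ K, Minimal (fun K => K ⊆ S.J0 μ ∧ w ∈ S.WI K) K :=
    (Set.toFinite {K | K ⊆ S.J0 μ ∧ w ∈ S.WI K}).exists_minimal ⟨_, subset_rfl, hw⟩
  have horth : ∀ i ∈ I, i ∉ K → ∀ k ∈ K, S.coroot k (S.root i) = 0 := by
    intro i hi hiK k hk
    have h1 := hfix K hK1 hK2 i hi hiK
    have h2 := dom_stab (neg_root_dom hiK) hK2 (by rw [map_neg, h1])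
    have h3 := hmin ⟨inter_subset_left.trans hK1, h2⟩ inter_subset_left hk
    have := h3.2
    simpa using this
  have hwalk : ∀ i j : I, (S.diagram.induce I).Walk j i → (j : Fin m) ∉ K → (i : Fin m) ∉ K := by
    intro i j p
    induction p with
    | nil => exact id
    | cons h p ih =>
      intro hj
      apply ih
      intro hK
      have := horth _ (Subtype.property _) hj _ hK
      rw [S.pairing] at this
      exact h.2.2 (by exact_mod_cast this)
  have hdisj : ∀ i ∈ I, i ∉ K := by
    intro i hi
    obtain ⟨j, hj, hr⟩ := hcon ⟨i, hi⟩
    obtain ⟨p⟩ := hr.symm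
    exact hwalk _ _ p (fun h => hj (hK1 h))
  refine S.WI_mono ?_ hK2
  intro k hk
  exact ⟨hK1 hk, fun h => hdisj k h hk, fun j hj => horth j hj (hdisj j hj) k hk⟩

/-- the direction space of the orbit is the span of `I` -/
lemma root_mem_dir {μ : V} {I : Set (Fin m)} (hcon : S.MuConnected μ I) {i : Fin m} (hi : i ∈ I) :
    S.root i ∈ Submodule.span ℝ {x | ∃ u ∈ S.WI I, x = u μ - μ} := by
  set D := Submodule.span ℝ {x | ∃ u ∈ S.WI I, x = u μ - μ} with hD
  have hst : ∀ u ∈ S.WI I, ∀ x ∈ D, u x ∈ D := by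
    intro u hu x hx
    induction hx using Submodule.span_induction with
    | mem x h =>
      obtain ⟨v, hv, rfl⟩ := h
      have e : u (v μ - μ) = ((u * v) μ - μ) - (u μ - μ) := by
        rw [map_sub, LinearEquiv.mul_apply]; abel
      rw [e]
      exact D.sub_mem (Submodule.subset_span ⟨_, mul_mem hu hv, rfl⟩)
        (Submodule.subset_span ⟨_, hu, rfl⟩)
    | zero => simp
    | add x y _ _ hx hy => rw [map_add]; exact D.add_mem hx hy
    | smul a x _ hx => rw [map_smul]; exact D.smul_mem _ hx
  have hwalk : ∀ i j : I, (S.diagram.induce I).Walk j i → S.root j ∈ D → S.root i ∈ D := by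
    intro i j p
    induction p with
    | nil => exact id
    | @cons a b c h p ih =>
      intro hj
      apply ih
      have h1 := hst _ (S.s_mem b.2) _ hj
      rw [s_apply] at h1
      have h2 := D.sub_mem hj h1
      rw [sub_sub_cancel] at h2
      refine (D.smul_mem_iff ?_).1 h2
      rw [S.pairing]
      have := h.2.2
      exact_mod_cast this
  obtain ⟨j, hj, hr⟩ := hcon ⟨i, hi⟩
  obtain ⟨p⟩ := hr.symm
  refine hwalk _ _ p ?_
  have h1 : S.s j μ - μ ∈ D := Submodule.subset_span ⟨_, S.s_mem j.2, rfl⟩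
  rw [s_apply, sub_sub_cancel_left] at h1
  exact (D.smul_mem_iff hj).1 (by simpa using D.neg_mem h1)

lemma commute_star {μ : V} {I : Set (Fin m)} :
    ∀ u ∈ S.WI I, ∀ v ∈ S.WI (S.starSet μ I), u * v = v * u := by
  intro u hu v hv
  have h : S.WI (S.starSet μ I) ≤ Subgroup.centralizer (S.WI I : Set (V ≃ₗ[ℝ] V)) := by
    rw [WI, WI, Subgroup.centralizer_closure, Subgroup.closure_le]
    rintro _ ⟨k, hk, rfl⟩
    rw [SetLike.mem_coe, Subgroup.mem_centralizer_iff]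
    rintro _ ⟨i, hi, rfl⟩
    have h1 : S.coroot k (S.root i) = 0 := hk.2.2 i hi
    have h2 : S.coroot i (S.root k) = 0 := by
      rw [S.pairing] at h1 ⊢
      have : S.A k i = 0 := by exact_mod_cast h1
      rw [(S.A_zero_iff k i).1 this]; simp
    ext x
    simp [s_apply, h1, h2]
    abel
  exact (Subgroup.mem_centralizer_iff.1 (h hv)) u hu

lemma fix_of_zero {μ : V} {K : Set (Fin m)} (hK : K ⊆ S.J0 μ) {w : V ≃ₗ[ℝ] V}
    (hw : w ∈ S.WI K) : w μ = μ := by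
  have : S.WI K ≤ MulAction.stabilizer (V ≃ₗ[ℝ] V) μ := by
    rw [WI, Subgroup.closure_le]
    rintro _ ⟨k, hk, rfl⟩
    have : S.coroot k μ = 0 := hK hk
    rw [SetLike.mem_coe, MulAction.mem_stabilizer_iff, LinearEquiv.smul_def, s_apply, this]
    simp
  exact this hw

lemma star_fix {μ : V} {I : Set (Fin m)} {w : V ≃ₗ[ℝ] V} (hw : w ∈ S.WI (S.starSet μ I)) :
    ∀ η ∈ S.face μ I, w η = η := by
  have : S.face μ I ⊆ {η | w η = η} := by
    apply convexHull_min
    · rintro _ ⟨u, hu, rfl⟩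
      have h := commute_star u hu w hw
      simp only [mem_setOf_eq]
      rw [← LinearEquiv.mul_apply, ← h, LinearEquiv.mul_apply,
        fix_of_zero (fun k hk => hk.1) hw]
    · intro x hx y hy a b _ _ _
      simp only [mem_setOf_eq] at *
      rw [map_add, map_smul, map_smul, hx, hy]
  exact fun η hη => this hη

lemma face_image {μ : V} {I : Set (Fin m)} {w : V ≃ₗ[ℝ] V} (hw : w ∈ S.WI I) :
    (fun x => w x) '' S.face μ I = S.face μ I := by
  have := w.toLinearMap.image_convexHull (orbitOf (S.WI I) μ)
  have e : (w.toLinearMap '' orbitOf (S.WI I) μ) = orbitOf (S.WI I) μ := by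
    ext x
    constructor
    · rintro ⟨_, ⟨u, hu, rfl⟩, rfl⟩
      exact ⟨w * u, mul_mem hw hu, rfl⟩
    · rintro ⟨u, hu, rfl⟩
      refine ⟨_, ⟨w⁻¹ * u, mul_mem (inv_mem hw) hu, rfl⟩, ?_⟩
      change (w * (w⁻¹ * u)) μ = u μ
      rw [mul_inv_cancel_left]
  rw [e] at this
  exact this

lemma face_sub {μ : V} (hμ : μ ∈ S.chamber) {I : Set (Fin m)} {x : V} (hx : x ∈ S.face μ I) :
    μ - x ∈ S.coneNonneg I := by
  have : S.face μ I ⊆ {x | μ - x ∈ S.coneNonneg I} := by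
    apply convexHull_min
    · rintro _ ⟨u, hu, rfl⟩
      exact dom_sub (fun k _ => hμ k) hu
    · intro x hx y hy a b ha hb hab
      simp only [mem_setOf_eq] at *
      have e : μ - (a • x + b • y) = a • (μ - x) + b • (μ - y) := by
        have : μ = (a + b) • μ := by rw [hab, one_smul]
        nth_rw 1 [this]; module
      rw [e]
      exact cone_add (cone_smul ha hx) (cone_smul hb hy)
  exact this hx

lemma mu_mem_face {μ : V} {I : Set (Fin m)} : μ ∈ S.face μ I :=
  subset_convexHull _ _ ⟨1, one_mem _, rfl⟩

lemma mu_extreme {μ : V} (hμ : μ ∈ S.chamber) {I : Set (Fin m)} :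
    μ ∈ (S.face μ I).extremePoints ℝ := by
  refine ⟨mu_mem_face, ?_⟩
  rintro x hx y hy ⟨a, b, ha, hb, hab, h⟩
  have h1 := cone_smul ha.le (face_sub hμ hx)
  have h2 := cone_smul hb.le (face_sub hμ hy)
  have e : a • (μ - x) + b • (μ - y) = 0 := by
    have : a • (μ - x) + b • (μ - y) = (a + b) • μ - (a • x + b • y) := by module
    rw [this, hab, h, one_smul, sub_self]
  have h3 := cone_add_eq_zero h1 h2 e
  rcases smul_eq_zero.1 h3 with h | h
  · exact absurd h ha.ne'
  · exact (sub_eq_zero.1 h).symm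

/-- set stabilizer -/
def fstab (F : Set V) : Subgroup (V ≃ₗ[ℝ] V) where
  carrier := {w | (fun x => w x) '' F = F}
  one_mem' := by simp
  mul_mem' := by
    intro a b ha hb
    simp only [mem_setOf_eq] at *
    have : (fun x => (a * b) x) '' F = (fun x => a x) '' ((fun x => b x) '' F) := by
      rw [image_image]; rfl
    rw [this, hb, ha]
  inv_mem' := by
    intro a ha
    simp only [mem_setOf_eq] at *
    nth_rw 1 [← ha]
    rw [image_image]
    have : ∀ x, a⁻¹ (a x) = x := fun x => by
      rw [← LinearEquiv.mul_apply, inv_mul_cancel]; rfl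
    simp [this]

lemma mem_fstab {F : Set V} {w : V ≃ₗ[ℝ] V} : w ∈ fstab F ↔ (fun x => w x) '' F = F := Iff.rfl

lemma fix_mu_mem {μ : V} (hμ : μ ∈ S.chamber) {w : V ≃ₗ[ℝ] V} (hw : w ∈ S.W) (h : w μ = μ) :
    w ∈ S.WI (S.J0 μ) := by
  rw [W_eq] at hw
  have := dom_stab (fun k _ => hμ k) hw h
  exact S.WI_mono inter_subset_right this

lemma inv_apply_of {w : V ≃ₗ[ℝ] V} {x y : V} (h : w x = y) : w⁻¹ y = x := by
  rw [← h, ← LinearEquiv.mul_apply, inv_mul_cancel]; rfl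

/-- an element preserving `F` and `μ` maps the span of `I` to itself. -/
lemma fstab_span {μ : V} (hμ : μ ∈ S.chamber) {I : Set (Fin m)} (hcon : S.MuConnected μ I)
    {w : V ≃ₗ[ℝ] V} (hF : w ∈ fstab (S.face μ I)) (h : w μ = μ) {i : Fin m} (hi : i ∈ I) :
    w (S.root i) ∈ Submodule.span ℝ (S.root '' I) := by
  have : Submodule.span ℝ {x | ∃ u ∈ S.WI I, x = u μ - μ} ≤
      (Submodule.span ℝ (S.root '' I)).comap w.toLinearMap := by
    rw [Submodule.span_le]
    rintro _ ⟨u, hu, rfl⟩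
    have h1 : w (u μ) ∈ S.face μ I := by
      rw [← mem_fstab.1 hF]
      exact ⟨u μ, subset_convexHull _ _ ⟨u, hu, rfl⟩, rfl⟩
    have h2 := cone_subset_span (face_sub hμ h1)
    change w (u μ - μ) ∈ Submodule.span ℝ (S.root '' I)
    rw [map_sub, h, ← neg_sub]
    exact Submodule.neg_mem _ h2
  exact this (root_mem_dir hcon hi)

lemma fstab_mem {μ : V} (hμ : μ ∈ S.chamber) {I : Set (Fin m)} (hcon : S.MuConnected μ I)
    {w : V ≃ₗ[ℝ] V} (hw : w ∈ S.WI (S.J0 μ)) (hF : w ∈ fstab (S.face μ I))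
    (hpos : ∀ k ∈ I ∩ S.J0 μ, w⁻¹ (S.root k) ∈ S.coneNonneg univ) :
    w ∈ S.WI (S.starSet μ I) := by
  apply core hcon hw
  intro K hK hwK i hi hiK
  have hx := dom_sub (neg_root_dom hiK) hwK
  have hy := dom_sub (neg_root_dom hiK) (inv_mem hwK)
  have ex : ∀ v : V ≃ₗ[ℝ] V, -S.root i - v (-S.root i) = v (S.root i) - S.root i := by
    intro v; rw [map_neg]; abel
  rw [ex] at hx hy
  have h1 := fstab_span hμ hcon hF (fix_of_zero subset_rfl hw) hi
  have h2 := cone_inter_span hx (Submodule.sub_mem _ h1 (Submodule.subset_span ⟨i, hi, rfl⟩))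
  have h3 : w⁻¹ (w (S.root i) - S.root i) ∈ S.coneNonneg univ :=
    cone_map w⁻¹ (fun k hk => hpos k ⟨hk.2, hK hk.1⟩) h2
  have h4 : w⁻¹ (w (S.root i) - S.root i) = 0 := by
    refine cone_add_eq_zero h3 hy ?_
    rw [map_sub, inv_apply_of rfl]; abel
  exact sub_eq_zero.1 ((LinearEquiv.map_eq_zero_iff _).1 h4)

lemma fstab_mem' {μ : V} (hμ : μ ∈ S.chamber) {I : Set (Fin m)} (hcon : S.MuConnected μ I)
    {w : V ≃ₗ[ℝ] V} (hw : w ∈ S.WI (S.J0 μ)) (hF : w ∈ fstab (S.face μ I)) :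
    w ∈ S.WI (I ∪ S.starSet μ I) := by
  classical
  have hex : ∃ n, ∃ u ∈ S.WI (I ∩ S.J0 μ), S.LE univ n (w⁻¹ * u) := by
    obtain ⟨n, hn⟩ := exists_LE (inv_mem hw)
    exact ⟨n, 1, one_mem _, by rw [mul_one]; exact hn.mono (subset_univ _) le_rfl⟩
  obtain ⟨u, hu, hn⟩ := Nat.find_spec hex
  have hmin := fun d (h : d < Nat.find hex) => Nat.find_min hex h
  generalize Nat.find hex = n at *
  have huI : u ∈ S.WI I := S.WI_mono inter_subset_left hu
  have key : u⁻¹ * w ∈ S.WI (S.starSet μ I) := by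
    apply fstab_mem hμ hcon
    · exact mul_mem (inv_mem (S.WI_mono inter_subset_right hu)) hw
    · exact mul_mem (inv_mem (face_image huI)) hF
    · intro k hk
      rw [mul_inv_rev, inv_inv]
      rcases positivity_main n _ hn k (mem_univ k) with ⟨n', hn', h⟩ | h
      · exact absurd ⟨u * S.s k, mul_mem hu (S.s_mem hk), by rw [← mul_assoc]; exact h⟩
          (hmin n' (by omega))
      · exact h
  have : w = u * (u⁻¹ * w) := by rw [mul_inv_cancel_left]
  rw [this]
  exact mul_mem (S.WI_mono subset_union_left huI) (S.WI_mono subset_union_right key)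

end Aux

end GCMRealization

open GCMRealization in
theorem statement_12 {m : ℕ} {V : Type*} [NormedAddCommGroup V] [NormedSpace ℝ V]
    (S : GCMRealization m V) (μ : V) (hμ : μ ∈ S.chamber)
    (I : Set (Fin m)) (hcon : S.MuConnected μ I) :
    ({w : V ≃ₗ[ℝ] V | w ∈ S.W ∧ ∀ η ∈ S.face μ I, w η = η} =
      (S.WI (S.starSet μ I) : Set (V ≃ₗ[ℝ] V))) ∧
    ({w : V ≃ₗ[ℝ] V | w ∈ S.W ∧ (fun x => w x) '' S.face μ I = S.face μ I} =
      (S.WI (I ∪ S.starSet μ I) : Set (V ≃ₗ[ℝ] V))) ∧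
    (∀ u ∈ S.WI I, ∀ v ∈ S.WI (S.starSet μ I), u * v = v * u) ∧
    S.WI I ⊓ S.WI (S.starSet μ I) = ⊥ ∧
    (∀ w ∈ S.WI (I ∪ S.starSet μ I), ∃ u ∈ S.WI I, ∃ v ∈ S.WI (S.starSet μ I), w = u * v) := by
  refine ⟨?_, ?_, commute_star, ?_, ?_⟩
  · ext w
    constructor
    · rintro ⟨hw, h⟩
      have hwμ := h μ mu_mem_face
      apply core hcon (fix_mu_mem hμ hw hwμ)
      intro K _ _ i hi _
      have : Submodule.span ℝ {x | ∃ u ∈ S.WI I, x = u μ - μ} ≤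
          LinearMap.ker (w.toLinearMap - LinearMap.id) := by
        rw [Submodule.span_le]
        rintro _ ⟨u, hu, rfl⟩
        have h1 : w (u μ) = u μ := h _ (subset_convexHull _ _ ⟨u, hu, rfl⟩)
        simp [h1, hwμ]
      have := this (root_mem_dir hcon hi)
      simpa [sub_eq_zero] using this
    · intro hw
      exact ⟨by rw [S.W_eq]; exact S.WI_mono (subset_univ _) hw, star_fix hw⟩
  · ext w
    constructor
    · rintro ⟨hw, hF⟩
      have h1 : w μ ∈ (S.face μ I).extremePoints ℝ := by
        have h2 := image_extremePoints (𝕜 := ℝ) w (S.face μ I)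
        have h3 : w '' S.face μ I = S.face μ I := hF
        rw [h3] at h2
        rw [← h2]
        exact ⟨μ, mu_extreme hμ, rfl⟩
      obtain ⟨u, hu, hu'⟩ := extremePoints_convexHull_subset h1
      have h3 : u⁻¹ * w ∈ S.WI (I ∪ S.starSet μ I) := by
        apply fstab_mem' hμ hcon
        · apply fix_mu_mem hμ
          · refine mul_mem (inv_mem ?_) hw
            rw [S.W_eq]; exact S.WI_mono (subset_univ _) hu
          · exact inv_apply_of hu'
        · exact mul_mem (inv_mem (face_image hu)) hF
      have : w = u * (u⁻¹ * w) := by rw [mul_inv_cancel_left]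
      rw [this]
      exact mul_mem (S.WI_mono subset_union_left hu) h3
    · intro hw
      refine ⟨by rw [S.W_eq]; exact S.WI_mono (subset_univ _) hw, ?_⟩
      have : S.WI (I ∪ S.starSet μ I) ≤ fstab (S.face μ I) := by
        rw [WI, Subgroup.closure_le]
        rintro _ ⟨k, hk | hk, rfl⟩
        · exact face_image (S.s_mem hk)
        · have := star_fix (μ := μ) (I := I) (S.s_mem hk)
          rw [SetLike.mem_coe, mem_fstab, image_congr this, image_id']
      exact this hw
  · rw [eq_bot_iff]
    rintro w ⟨h1, h2⟩
    rw [Subgroup.mem_bot]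
    ext x
    have h3 := S.span_coef (WI_sub_mem h1 x)
    have h4 := S.span_coef (WI_sub_mem h2 x)
    obtain ⟨c, hc, hc'⟩ := h3
    obtain ⟨d, hd, hd'⟩ := h4
    obtain rfl := S.coef_unique (hc'.symm.trans hd')
    have : c = 0 := by
      funext i
      by_cases hi : i ∈ I
      · exact hd i (fun h => h.2.1 hi)
      · exact hc i hi
    rw [this] at hc'
    simpa [sub_eq_zero] using hc'
  · intro w hw
    obtain ⟨n, hn⟩ := exists_LE hw
    clear hw
    induction n generalizing w with
    | zero =>
      rcases hn.last with rfl | ⟨k, hk, d, hd, _⟩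
      · exact ⟨1, one_mem _, 1, one_mem _, by simp⟩
      · omega
    | succ n ih =>
      rcases hn.last with rfl | ⟨k, hk, d, hd, v, hv, rfl⟩
      · exact ⟨1, one_mem _, 1, one_mem _, by simp⟩
      · obtain ⟨a, ha, b, hb, rfl⟩ := ih v (hv.mono subset_rfl (by omega))
        rcases hk with hk | hk
        · refine ⟨a * S.s k, mul_mem ha (S.s_mem hk), b, hb, ?_⟩
          rw [mul_assoc, ← commute_star _ (S.s_mem hk) _ hb, mul_assoc]
        · exact ⟨a, ha, b * S.s k, mul_mem hb (S.s_mem hk), by rw [mul_assoc]⟩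
end

section
/- For every face F of H there exists w ∈ W such that wF is a fundamental face of H; and this fundamental face is unique: if wF and w'F are both fundamental faces for some w, w' ∈ W, then wF = w'F. -/
open Set Module

namespace Sub14

section TwoGen

variable {G : Type*} [Group G]

/-- Evaluation of words in two generators; the head of the list is the rightmost letter. -/
def ev2 (a b : G) : List Bool → G
  | [] => 1
  | x :: l => ev2 a b l * (cond x b a)

def altw : ℕ → List Bool
  | 0 => []
  | k + 1 => decide (k % 2 = 0) :: altw k

theorem altw_length (k : ℕ) : (altw k).length = k := by
  induction k with
  | zero => rfl
  | succ k ih => simp [altw, ih]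

def Good (a b : G) (l : List Bool) : Prop :=
  ∀ l', (ev2 a b l' = ev2 a b l ∨ ev2 a b l' = a * ev2 a b l) → l.length ≤ l'.length

theorem good_tail {a b : G} {x : Bool} {l : List Bool} (h : Good a b (x :: l)) : Good a b l := by
  intro l' hl'
  have := h (x :: l') (by
    rcases hl' with h1 | h1
    · left; simp [ev2, h1]
    · right; simp [ev2, h1, mul_assoc])
  simpa using this

theorem good_alt {a b : G} (ha : a * a = 1) (hb : b * b = 1) :
    ∀ l : List Bool, Good a b l → l = altw l.length := by
  intro l
  induction l with
  | nil => intro _; rfl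
  | cons x l ih =>
    intro h
    have hl := ih (good_tail h)
    simp only [List.length_cons, altw]
    congr 1
    rcases l with _ | ⟨y, l'⟩
    · cases x
      · exfalso
        have := h [] (by right; simp [ev2, ha])
        simp at this
      · simp
    · have hxy : x ≠ y := by
        rintro rfl
        have := h l' (by
          left
          cases x <;> simp [ev2, mul_assoc, ha, hb])
        simp at this
      have hy : y = decide (l'.length % 2 = 0) := by
        simp only [List.length_cons, altw] at hl
        exact (List.cons.inj hl).1
      rw [List.length_cons]
      rcases Nat.mod_two_eq_zero_or_one l'.length with h2 | h2
      · have h3 : (l'.length + 1) % 2 = 1 := by omega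
        have hy' : y = true := by rw [hy, h2]; rfl
        rw [h3]; subst hy'
        revert hxy; cases x <;> decide
      · have h3 : (l'.length + 1) % 2 = 0 := by omega
        have hy' : y = false := by rw [hy, h2]; rfl
        rw [h3]; subst hy'
        revert hxy; cases x <;> decide

theorem good_alt_down {a b : G} (M : ℕ) : ∀ k, Good a b (altw (M + k)) → Good a b (altw M) := by
  intro k
  induction k with
  | zero => exact id
  | succ k ih => intro h; exact ih (good_tail h)

theorem good_lt {a b : G} (ha : a * a = 1) (hb : b * b = 1) (M : ℕ)
    (hM : a * ev2 a b (altw (M + 1)) = ev2 a b (altw M)) (l : List Bool) (h : Good a b l) :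
    l.length < M + 1 := by
  by_contra hc
  push Not at hc
  obtain ⟨k, hk⟩ := Nat.exists_eq_add_of_le hc
  have h1 := good_alt ha hb l h
  rw [h1, hk] at h
  have h2 := good_alt_down (M + 1) k h (altw M) (Or.inr hM.symm)
  simp only [altw_length] at h2
  omega

end TwoGen

/-- coefficients -/
def cd (P Q : ℝ) : ℕ → ℝ × ℝ
  | 0 => (1, 0)
  | k + 1 => if k % 2 = 0 then ((cd P Q k).1, -(cd P Q k).2 + P * (cd P Q k).1)
      else (-(cd P Q k).1 + Q * (cd P Q k).2, (cd P Q k).2)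

theorem cd_large (P Q : ℝ) (hP : 0 ≤ P) (hQ : 0 ≤ Q) (h : 4 ≤ P * Q) (k : ℕ) :
    0 ≤ (cd P Q k).1 ∧ 0 ≤ (cd P Q k).2 ∧
    (k % 2 = 0 → 2 * (cd P Q k).2 ≤ P * (cd P Q k).1) ∧
    (k % 2 = 1 → 2 * (cd P Q k).1 ≤ Q * (cd P Q k).2) := by
  induction k with
  | zero => simp [cd, hP]
  | succ k ih =>
    obtain ⟨h1, h2, h3, h4⟩ := ih
    rcases Nat.mod_two_eq_zero_or_one k with hk | hk
    · have e : cd P Q (k+1) = ((cd P Q k).1, -(cd P Q k).2 + P * (cd P Q k).1) := by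
        simp [cd, hk]
      rw [e]
      have h3 := h3 hk
      refine ⟨h1, by dsimp only; linarith, fun h => by omega, fun _ => ?_⟩
      dsimp only
      have := mul_le_mul_of_nonneg_left h3 hQ
      have := mul_le_mul_of_nonneg_right h h1
      nlinarith
    · have e : cd P Q (k+1) = (-(cd P Q k).1 + Q * (cd P Q k).2, (cd P Q k).2) := by
        simp [cd, hk]
      rw [e]
      have h4 := h4 hk
      refine ⟨by dsimp only; linarith, h2, fun _ => ?_, fun h => by omega⟩
      dsimp only
      have := mul_le_mul_of_nonneg_left h4 hP
      have := mul_le_mul_of_nonneg_right h h2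
      nlinarith

open GCMRealization

variable {m : ℕ} {V : Type*} [NormedAddCommGroup V] [NormedSpace ℝ V]
variable (S : GCMRealization m V)

theorem s_apply (i : Fin m) (x : V) : S.s i x = x - S.coroot i x • S.root i := by
  rfl

theorem cr_self (i : Fin m) : S.coroot i (S.root i) = 2 := by
  rw [S.pairing, S.A_diag]; norm_num

theorem s_sq (i : Fin m) : S.s i * S.s i = 1 := by
  ext x
  simp only [LinearEquiv.mul_apply, s_apply, map_sub, map_smul, cr_self, smul_eq_mul,
    LinearEquiv.coe_one, id_eq]
  module

theorem s_s (i : Fin m) (x : V) : S.s i (S.s i x) = x := by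
  have := congrArg (fun g : V ≃ₗ[ℝ] V => g x) (s_sq S i)
  simpa using this

theorem coroot_s (i : Fin m) (x : V) : S.coroot i (S.s i x) = - S.coroot i x := by
  rw [s_apply, map_sub, map_smul, cr_self, smul_eq_mul]; ring

theorem s_step1 (i j : Fin m) (p : ℝ) (hp : S.coroot i (S.root j) = p) (x : V) (c d : ℝ) :
    S.s i (x + c • S.root i + d • S.root j) =
      x + (-c - S.coroot i x - p * d) • S.root i + d • S.root j := by
  rw [s_apply]
  simp only [map_add, map_smul, cr_self, hp, smul_eq_mul]
  module

theorem s_step2 (i j : Fin m) (q : ℝ) (hq : S.coroot j (S.root i) = q) (x : V) (c d : ℝ) :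
    S.s j (x + c • S.root i + d • S.root j) =
      x + c • S.root i + (-d - S.coroot j x - q * c) • S.root j := by
  rw [s_apply]
  simp only [map_add, map_smul, cr_self, hq, smul_eq_mul]
  module

theorem ev_cd (i j : Fin m) (k : ℕ) (x : V) :
    S.coroot i (ev2 (S.s i) (S.s j) (altw k) x) =
      (cd (-S.coroot i (S.root j)) (-S.coroot j (S.root i)) k).1 * S.coroot i x +
      (cd (-S.coroot i (S.root j)) (-S.coroot j (S.root i)) k).2 * S.coroot j x := by
  induction k generalizing x with
  | zero => simp [altw, ev2, cd]
  | succ k ih =>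
    simp only [altw, ev2, LinearEquiv.mul_apply, ih, cd]
    by_cases hk : k % 2 = 0
    · simp only [hk, decide_true, cond_true, if_true]
      rw [coroot_s, s_apply, map_sub, map_smul, smul_eq_mul]; ring
    · simp only [hk, decide_false, cond_false, if_false]
      rw [coroot_s, s_apply, map_sub, map_smul, smul_eq_mul]; ring

theorem rel_of (i j : Fin m) (M : ℕ) (p q : ℝ) (hp : S.coroot i (S.root j) = p)
    (hq : S.coroot j (S.root i) = q)
    (h : (p = 0 ∧ q = 0 ∧ M = 1) ∨ (p = -1 ∧ q = -1 ∧ M = 2) ∨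
      (p = -1 ∧ q = -2 ∧ M = 3) ∨ (p = -2 ∧ q = -1 ∧ M = 3) ∨
      (p = -1 ∧ q = -3 ∧ M = 5) ∨ (p = -3 ∧ q = -1 ∧ M = 5)) :
    S.s i * ev2 (S.s i) (S.s j) (altw (M + 1)) = ev2 (S.s i) (S.s j) (altw M) := by
  ext x
  have e : x = x + (0:ℝ) • S.root i + (0:ℝ) • S.root j := by simp
  rcases h with ⟨rfl, rfl, rfl⟩ | ⟨rfl, rfl, rfl⟩ | ⟨rfl, rfl, rfl⟩ | ⟨rfl, rfl, rfl⟩ |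
    ⟨rfl, rfl, rfl⟩ | ⟨rfl, rfl, rfl⟩ <;>
  · rw [e]
    simp only [altw, ev2, LinearEquiv.mul_apply, Nat.reduceMod, decide_true, cond_true, one_ne_zero,
      decide_false, cond_false, LinearEquiv.coe_one, id_eq, s_step1 S i j _ hp, s_step2 S i j _ hq,
      Nat.zero_mod]
    congr 1
    · congr 2; ring
    · congr 1; ring

theorem rank_two (i j : Fin m) (hij : i ≠ j) (l : List Bool) (h : Good (S.s i) (S.s j) l) :
    ∃ c d : ℝ, 0 ≤ c ∧ 0 ≤ d ∧ ∀ x, S.coroot i (ev2 (S.s i) (S.s j) l x) =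
      c * S.coroot i x + d * S.coroot j x := by
  have hl := good_alt (s_sq S i) (s_sq S j) l h
  have hp := S.pairing i j
  have hq := S.pairing j i
  have hp0 := S.A_offdiag i j hij
  have hq0 := S.A_offdiag j i hij.symm
  have hz := S.A_zero_iff i j
  suffices hs : 0 ≤ (cd (-S.coroot i (S.root j)) (-S.coroot j (S.root i)) l.length).1 ∧
      0 ≤ (cd (-S.coroot i (S.root j)) (-S.coroot j (S.root i)) l.length).2 by
    refine ⟨_, _, hs.1, hs.2, fun x => ?_⟩
    rw [← ev_cd, ← hl]
  generalize S.A i j = p at *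
  generalize S.A j i = q at *
  by_cases h4 : 4 ≤ p * q
  · have h5 : (4:ℝ) ≤ (p:ℝ) * q := by exact_mod_cast h4
    have hpr : (p:ℝ) ≤ 0 := by exact_mod_cast hp0
    have hqr : (q:ℝ) ≤ 0 := by exact_mod_cast hq0
    have := cd_large (-S.coroot i (S.root j)) (-S.coroot j (S.root i)) (by rw [hp]; linarith)
      (by rw [hq]; linarith) (by rw [hp, hq]; linarith) l.length
    exact ⟨this.1, this.2.1⟩
  · have hcase : (p = 0 ∧ q = 0) ∨ (p = -1 ∧ q = -1) ∨ (p = -1 ∧ q = -2) ∨ (p = -2 ∧ q = -1) ∨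
        (p = -1 ∧ q = -3) ∨ (p = -3 ∧ q = -1) := by
      by_cases hp1 : p = 0
      · exact Or.inl ⟨hp1, hz.1 hp1⟩
      have hq1 : q ≠ 0 := fun h => hp1 (hz.2 h)
      have hp2 : p ≤ -1 := by omega
      have hq2 : q ≤ -1 := by omega
      have hp3 : -3 ≤ p := by nlinarith
      have hq3 : -3 ≤ q := by nlinarith
      interval_cases p <;> interval_cases q <;> omega
    have key : ∀ M, ((p:ℝ) = 0 ∧ (q:ℝ) = 0 ∧ M = 1) ∨ ((p:ℝ) = -1 ∧ (q:ℝ) = -1 ∧ M = 2) ∨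
      ((p:ℝ) = -1 ∧ (q:ℝ) = -2 ∧ M = 3) ∨ ((p:ℝ) = -2 ∧ (q:ℝ) = -1 ∧ M = 3) ∨
      ((p:ℝ) = -1 ∧ (q:ℝ) = -3 ∧ M = 5) ∨ ((p:ℝ) = -3 ∧ (q:ℝ) = -1 ∧ M = 5) →
        l.length < M + 1 := fun M hM =>
      good_lt (s_sq S i) (s_sq S j) M (rel_of S i j M p q hp hq hM) l h
    rw [hp, hq]
    clear hl hz
    generalize l.length = n at *
    rcases hcase with ⟨rfl, rfl⟩ | ⟨rfl, rfl⟩ | ⟨rfl, rfl⟩ | ⟨rfl, rfl⟩ | ⟨rfl, rfl⟩ | ⟨rfl, rfl⟩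
    · have := key 1 (by norm_num)
      interval_cases n <;> norm_num [cd]
    · have := key 2 (by norm_num)
      interval_cases n <;> norm_num [cd]
    · have := key 3 (by norm_num)
      interval_cases n <;> norm_num [cd]
    · have := key 3 (by norm_num)
      interval_cases n <;> norm_num [cd]
    · have := key 5 (by norm_num)
      interval_cases n <;> norm_num [cd]
    · have := key 5 (by norm_num)
      interval_cases n <;> norm_num [cd]

/-! length -/

theorem s_mem (i : Fin m) : S.s i ∈ S.W := Subgroup.subset_closure ⟨i, rfl⟩

theorem exists_word {w : V ≃ₗ[ℝ] V} (hw : w ∈ S.W) :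
    ∃ l : List (Fin m), w = (l.map S.s).prod := by
  unfold GCMRealization.W at hw
  induction hw using Subgroup.closure_induction_left with
  | one => exact ⟨[], by simp⟩
  | mul_left x hx y _ ih =>
    obtain ⟨i, rfl⟩ := hx
    obtain ⟨l, rfl⟩ := ih
    exact ⟨i :: l, by simp⟩
  | inv_mul_cancel x hx y _ ih =>
    obtain ⟨i, rfl⟩ := hx
    obtain ⟨l, rfl⟩ := ih
    refine ⟨i :: l, ?_⟩
    rw [inv_eq_of_mul_eq_one_left (s_sq S i)]; simp

theorem len_spec {w : V ≃ₗ[ℝ] V} (hw : w ∈ S.W) :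
    ∃ l : List (Fin m), l.length = S.len w ∧ w = (l.map S.s).prod := by
  obtain ⟨l, hl⟩ := exists_word S hw
  exact Nat.sInf_mem (s := {k | ∃ l : List (Fin m), l.length = k ∧ w = (l.map S.s).prod})
    ⟨_, l, rfl, hl⟩

theorem len_le (l : List (Fin m)) : S.len (l.map S.s).prod ≤ l.length :=
  Nat.sInf_le ⟨l, rfl, rfl⟩

theorem prod_mem (l : List (Fin m)) : (l.map S.s).prod ∈ S.W := by
  apply Subgroup.list_prod_mem
  intro x hx
  obtain ⟨i, _, rfl⟩ := List.mem_map.1 hx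
  exact s_mem S i

theorem len_s_mul (i : Fin m) {w : V ≃ₗ[ℝ] V} (hw : w ∈ S.W) :
    S.len (S.s i * w) ≤ S.len w + 1 := by
  obtain ⟨l, hl, rfl⟩ := len_spec S hw
  rw [← hl]
  simpa using len_le S (i :: l)

/-- peel off the leftmost letter -/
theorem exists_peel {w : V ≃ₗ[ℝ] V} (hw : w ∈ S.W) (h1 : w ≠ 1) :
    ∃ i w', w' ∈ S.W ∧ w = S.s i * w' ∧ S.len w' < S.len w := by
  obtain ⟨l, hl, hl'⟩ := len_spec S hw
  rcases l with _ | ⟨i, l⟩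
  · simp at hl'; exact absurd hl' h1
  · refine ⟨i, (l.map S.s).prod, prod_mem S l, by simpa using hl', ?_⟩
    rw [← hl]
    have := len_le S l
    simp; omega

theorem ev2_mem (i j : Fin m) (l : List Bool) : ev2 (S.s i) (S.s j) l ∈ S.W := by
  induction l with
  | nil => exact one_mem _
  | cons x l ih =>
    refine mul_mem ih ?_
    cases x <;> simp [s_mem]

theorem len_ev2_mul (i j : Fin m) (l : List Bool) : ∀ {v : V ≃ₗ[ℝ] V}, v ∈ S.W →
    S.len (ev2 (S.s i) (S.s j) l * v) ≤ l.length + S.len v := by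
  induction l with
  | nil => intro v hv; simp [ev2]
  | cons x l ih =>
    intro v hv
    simp only [ev2, mul_assoc, List.length_cons]
    cases x
    · have h1 := ih (mul_mem (s_mem S i) hv)
      have h2 := len_s_mul S i hv
      simp only [cond_false]; omega
    · have h1 := ih (mul_mem (s_mem S j) hv)
      have h2 := len_s_mul S j hv
      simp only [cond_true]; omega

theorem key_pos : ∀ n : ℕ, ∀ w ∈ S.W, S.len w = n → ∀ i, S.len w ≤ S.len (S.s i * w) →
    ∀ y ∈ S.chamber, 0 ≤ S.coroot i (w y) := by
  intro n
  induction n using Nat.strong_induction_on with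
  | _ n ih =>
  intro w hw hn i hi y hy
  by_cases h1 : w = 1
  · subst h1; simpa using hy i
  obtain ⟨j, w', hw', hww', hlt⟩ := exists_peel S hw h1
  have hij : i ≠ j := by
    rintro rfl
    rw [hww', ← mul_assoc, s_sq, one_mul, ← hww'] at hi
    omega
  -- decompositions
  let D : ℕ → Prop := fun k => ∃ v ∈ S.W, ∃ l : List Bool, S.len v = k ∧
    w = ev2 (S.s i) (S.s j) l * v ∧ l.length + k = n
  have hw'len : S.len w = S.len w' + 1 := by
    have := len_s_mul S j hw'
    rw [← hww'] at this
    omega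
  have hD : D (S.len w') := ⟨w', hw', [true], rfl, by simpa [ev2] using hww', by simp; omega⟩
  classical
  have hex : ∃ k, D k := ⟨_, hD⟩
  obtain ⟨v, hv, l, hvk, hwl, hlen⟩ := Nat.find_spec hex
  have hmin : ∀ k, D k → Nat.find hex ≤ k := fun k hk => Nat.find_min' hex hk
  have hkle := hmin _ hD
  generalize Nat.find hex = k at *
  have hpos : ∀ x : Bool, S.len v ≤ S.len (cond x (S.s j) (S.s i) * v) := by
    intro x
    by_contra hc
    push Not at hc
    have hxm : cond x (S.s j) (S.s i) * v ∈ S.W := by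
      refine mul_mem ?_ hv
      cases x <;> simp [s_mem]
    have hxx : cond x (S.s j) (S.s i) * cond x (S.s j) (S.s i) = 1 := by
      cases x <;> simp [s_sq]
    have e : w = ev2 (S.s i) (S.s j) (x :: l) * (cond x (S.s j) (S.s i) * v) := by
      rw [ev2, mul_assoc, ← mul_assoc (cond x (S.s j) (S.s i)) _ v, hxx, one_mul, hwl]
    have hb := len_ev2_mul S i j (x :: l) hxm
    rw [← e, List.length_cons] at hb
    have := hmin (S.len (cond x (S.s j) (S.s i) * v))
      ⟨_, hxm, x :: l, rfl, e, by rw [List.length_cons]; omega⟩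
    omega
  have hvi : 0 ≤ S.coroot i (v y) := ih k (by omega) v hv hvk i (hpos false) y hy
  have hvj : 0 ≤ S.coroot j (v y) := ih k (by omega) v hv hvk j (hpos true) y hy
  have hgood : Good (S.s i) (S.s j) l := by
    intro l' hl'
    have hb := len_ev2_mul S i j l' hv
    rcases hl' with h | h
    · rw [h, ← hwl] at hb; omega
    · rw [h, mul_assoc, ← hwl] at hb; omega
  obtain ⟨c, d, hc, hd, hcd⟩ := rank_two S i j hij l hgood
  rw [hwl, LinearEquiv.mul_apply, hcd]
  positivity

/-! Tits cone -/

def tits : Set V := {x | ∃ w ∈ S.W, ∃ c ∈ S.chamber, x = w c}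

theorem tits_smul {x : V} (hx : x ∈ tits S) {g : V ≃ₗ[ℝ] V} (hg : g ∈ S.W) : g x ∈ tits S := by
  obtain ⟨w, hw, c, hc, rfl⟩ := hx
  exact ⟨g * w, mul_mem hg hw, c, hc, rfl⟩

theorem chamber_convex : Convex ℝ S.chamber := by
  intro x hx y hy a b ha hb _ i
  have := hx i
  have := hy i
  simp only [map_add, map_smul, smul_eq_mul]
  positivity

theorem tits_seg : ∀ n : ℕ, ∀ w ∈ S.W, S.len w = n → ∀ x ∈ S.chamber, ∀ c ∈ S.chamber,
    ∀ t : ℝ, 0 ≤ t → t ≤ 1 → x + t • (w c - x) ∈ tits S := by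
  intro n
  induction n using Nat.strong_induction_on with
  | _ n ih =>
  intro w hw hn x hx c hc t ht0 ht1
  by_cases hch : x + t • (w c - x) ∈ S.chamber
  · exact ⟨1, one_mem _, _, hch, rfl⟩
  -- the finite set of walls separating
  classical
  let B : Finset (Fin m) := Finset.univ.filter fun i => S.coroot i (w c) < 0
  have hB : B.Nonempty := by
    by_contra hne
    rw [Finset.not_nonempty_iff_eq_empty] at hne
    apply hch
    intro i
    have h1 : 0 ≤ S.coroot i (w c) := by
      by_contra hh
      have : i ∈ B := by simp [B]; linarith
      simp [hne] at this
    have h2 := hx i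
    simp only [map_add, map_smul, map_sub, smul_eq_mul]
    nlinarith
  obtain ⟨i, hiB, hmin⟩ := Finset.exists_min_image B
    (fun i => S.coroot i x / (S.coroot i x - S.coroot i (w c))) hB
  have hineg : S.coroot i (w c) < 0 := by simpa [B] using hiB
  set t0 := S.coroot i x / (S.coroot i x - S.coroot i (w c)) with ht0def
  have hxi := hx i
  have hden : 0 < S.coroot i x - S.coroot i (w c) := by linarith
  have ht00 : 0 ≤ t0 := div_nonneg hxi hden.le
  have ht01 : t0 < 1 := by rw [ht0def, div_lt_one hden]; linarith
  have ht0eq : t0 * (S.coroot i x - S.coroot i (w c)) = S.coroot i x := by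
    rw [ht0def]; field_simp
  have hq : ∀ r : ℝ, 0 ≤ r → r ≤ t0 → x + r • (w c - x) ∈ S.chamber := by
    intro r hr0 hr k
    have h2 := hx k
    simp only [map_add, map_smul, map_sub, smul_eq_mul]
    by_cases hk : S.coroot k (w c) < 0
    · have h3 := hmin k (by simp [B, hk])
      have hden' : 0 < S.coroot k x - S.coroot k (w c) := by linarith
      have h4 : r ≤ S.coroot k x / (S.coroot k x - S.coroot k (w c)) := hr.trans h3
      rw [le_div_iff₀ hden'] at h4
      linarith
    · push Not at hk
      nlinarith
  have htt0 : t0 < t := by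
    by_contra hh
    push Not at hh
    exact hch (hq t ht0 hh)
  set q := x + t0 • (w c - x) with hqdef
  have hqC : q ∈ S.chamber := hq t0 ht00 le_rfl
  have hqi : S.coroot i q = 0 := by
    rw [hqdef]; simp only [map_add, map_smul, map_sub, smul_eq_mul]; linarith
  have hsq : S.s i q = q := by rw [s_apply, hqi]; simp
  have hlt : S.len (S.s i * w) < n := by
    by_contra hh
    have := key_pos S n w hw hn i (by omega) c hc
    linarith
  set r := (t - t0) / (1 - t0) with hr
  have h1t0 : 0 < 1 - t0 := by linarith
  have hr0 : 0 ≤ r := div_nonneg (by linarith) h1t0.le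
  have hr1 : r ≤ 1 := by rw [hr, div_le_one h1t0]; linarith
  have hreq : r * (1 - t0) = t - t0 := by rw [hr]; field_simp
  have hI := ih _ hlt (S.s i * w) (mul_mem (s_mem S i) hw) rfl q hqC c hc r hr0 hr1
  have hI2 := tits_smul S hI (s_mem S i)
  have e : S.s i (q + r • ((S.s i * w) c - q)) = x + t • (w c - x) := by
    rw [map_add, map_smul, map_sub, LinearEquiv.mul_apply, s_s, hsq, hqdef]
    have : t = t0 + r * (1 - t0) := by linarith
    rw [this]
    module
  rwa [e] at hI2

theorem tits_convex : Convex ℝ (tits S) := by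
  intro x hx y hy a b ha hb hab
  obtain ⟨w, hw, c, hc, rfl⟩ := hx
  obtain ⟨w', hw', c', hc', rfl⟩ := hy
  have h := tits_seg S _ (w⁻¹ * w') (mul_mem (inv_mem hw) hw') rfl c hc c' hc' b hb (by linarith)
  have h2 := tits_smul S h hw
  have e : w (c + b • ((w⁻¹ * w') c' - c)) = a • w c + b • w' c' := by
    have e1 : w ((w⁻¹ * w') c') = w' c' := by
      rw [← LinearEquiv.mul_apply, mul_inv_cancel_left]
    rw [map_add, map_smul, map_sub, e1]
    have : a = 1 - b := by linarith
    rw [this]; module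
  rwa [e] at h2

theorem hull_sub_tits {μ : V} (hμ : μ ∈ S.chamber) : S.orbitHull μ ⊆ tits S := by
  apply convexHull_min _ (tits_convex S)
  rintro _ ⟨w, hw, rfl⟩
  exact ⟨w, hw, μ, hμ, rfl⟩

theorem hull_stable {μ : V} {g : V ≃ₗ[ℝ] V} (hg : g ∈ S.W) {x : V} (hx : x ∈ S.orbitHull μ) :
    g x ∈ S.orbitHull μ := by
  have : S.orbitHull μ ⊆ (g : V →ₗ[ℝ] V) ⁻¹' S.orbitHull μ := by
    apply convexHull_min
    · rintro _ ⟨w, hw, rfl⟩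
      apply subset_convexHull
      exact ⟨g * w, mul_mem hg hw, rfl⟩
    · exact (convex_convexHull ℝ _).linear_preimage _
  exact this hx

theorem inv_app (g : V ≃ₗ[ℝ] V) (x : V) : g⁻¹ (g x) = x := by
  rw [← LinearEquiv.mul_apply, inv_mul_cancel]; rfl

theorem face_image {μ : V} {F : Set V} (hF : IsFaceOf (S.orbitHull μ) F) {g : V ≃ₗ[ℝ] V}
    (hg : g ∈ S.W) : IsFaceOf (S.orbitHull μ) ((fun x => g x) '' F) := by
  obtain ⟨hc, he⟩ := hF
  refine ⟨hc.linear_image (g : V →ₗ[ℝ] V), ?_, ?_⟩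
  · rintro _ ⟨x, hx, rfl⟩
    exact hull_stable S hg (he.subset hx)
  · rintro x hx y hy _ ⟨z, hz, rfl⟩ hzxy
    obtain ⟨a, b, ha, hb, hab, hz'⟩ := hzxy
    refine ⟨g⁻¹ x, he.left_mem_of_mem_openSegment (hull_stable S (inv_mem hg) hx)
      (hull_stable S (inv_mem hg) hy) hz ⟨a, b, ha, hb, hab, ?_⟩, ?_⟩
    · rw [← map_smul, ← map_smul, ← map_add, hz']; exact inv_app g z
    · simpa using inv_app g⁻¹ x

/-- algebraic relative interior -/
def core (F : Set V) : Set V := {p | p ∈ F ∧ ∀ x ∈ F, ∃ ε : ℝ, 0 < ε ∧ p + ε • (p - x) ∈ F}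

theorem ri_sub_core (F : Set V) : intrinsicInterior ℝ F ⊆ core F := by
  intro p hp
  refine ⟨intrinsicInterior_subset hp, fun x hx => ?_⟩
  obtain ⟨y, hy, rfl⟩ := mem_intrinsicInterior.1 hp
  have hxs : x ∈ affineSpan ℝ F := subset_affineSpan ℝ F hx
  have hmem : ∀ t : ℝ, (y : V) + t • ((y : V) - x) ∈ affineSpan ℝ F := by
    intro t
    have := AffineMap.lineMap_mem (-t) y.2 hxs
    rw [AffineMap.lineMap_apply] at this
    convert this using 1
    simp only [vsub_eq_sub, vadd_eq_add]
    module
  let f : ℝ → affineSpan ℝ F := fun t => ⟨(y : V) + t • ((y : V) - x), hmem t⟩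
  have hf : Continuous f := by
    apply Continuous.subtype_mk
    fun_prop
  have hf0 : f 0 = y := by ext; simp [f]
  have hnb : f ⁻¹' interior ((↑) ⁻¹' F) ∈ nhds (0 : ℝ) := by
    apply (isOpen_interior.preimage hf).mem_nhds
    rw [Set.mem_preimage, hf0]; exact hy
  obtain ⟨ε, hε, hball⟩ := Metric.mem_nhds_iff.1 hnb
  refine ⟨ε / 2, by positivity, ?_⟩
  have : ε / 2 ∈ Metric.ball (0:ℝ) ε := by
    rw [Metric.mem_ball, Real.dist_eq, sub_zero, abs_of_pos (by positivity)]; linarith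
  have h3 : f (ε / 2) ∈ ((↑) ⁻¹' F : Set (affineSpan ℝ F)) :=
    interior_subset (Set.mem_preimage.1 (hball this))
  exact h3

theorem core_convex {F : Set V} (hF : Convex ℝ F) : Convex ℝ (core F) := by
  intro p hp q hq a b ha hb hab
  refine ⟨hF hp.1 hq.1 ha hb hab, fun x hx => ?_⟩
  obtain ⟨e1, he1, h1⟩ := hp.2 x hx
  obtain ⟨e2, he2, h2⟩ := hq.2 x hx
  -- shrink to common epsilon
  have shrink : ∀ (r : V) (e e' : ℝ), r ∈ F → 0 < e → e ≤ e' → r + e' • (r - x) ∈ F →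
      r + e • (r - x) ∈ F := by
    intro r e e' hr he hee h
    have he' : 0 < e' := by linarith
    have := hF hr h (a := 1 - e / e') (b := e / e')
      (by rw [sub_nonneg, div_le_one he']; exact hee) (by positivity) (by ring)
    convert this using 1
    have : e = e / e' * e' := by field_simp
    nth_rw 1 [this]
    module
  refine ⟨min e1 e2, lt_min he1 he2, ?_⟩
  have k1 := shrink p _ e1 hp.1 (lt_min he1 he2) (min_le_left _ _) h1
  have k2 := shrink q _ e2 hq.1 (lt_min he1 he2) (min_le_right _ _) h2
  have := hF k1 k2 ha hb hab
  convert this using 1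
  have : a = 1 - b := by linarith
  rw [this]
  module

theorem core_image {F : Set V} {g : V ≃ₗ[ℝ] V} {p : V} (hp : p ∈ core F) :
    g p ∈ core ((fun x => g x) '' F) := by
  refine ⟨⟨p, hp.1, rfl⟩, ?_⟩
  rintro _ ⟨x, hx, rfl⟩
  obtain ⟨e, he, h⟩ := hp.2 x hx
  exact ⟨e, he, _, h, by simp⟩

theorem face_sub {H F F' : Set V} (hF : IsFaceOf H F) (hF' : IsFaceOf H F') {p : V}
    (hp : p ∈ core F) (hp' : p ∈ F') : F ⊆ F' := by
  intro x hx
  obtain ⟨e, he, h⟩ := hp.2 x hx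
  refine hF'.2.left_mem_of_mem_openSegment (hF.2.subset hx) (hF.2.subset h) hp'
    ⟨e / (1 + e), 1 / (1 + e), by positivity, by positivity, by field_simp; ring, ?_⟩
  have e1 : (e / (1 + e)) = 1 - 1 / (1 + e) := by field_simp; ring
  have e2 : 1 / (1 + e) * e = 1 - 1 / (1 + e) := by field_simp; ring
  rw [smul_add, smul_smul, e2, e1]
  module

theorem face_eq {H F F' : Set V} (hF : IsFaceOf H F) (hF' : IsFaceOf H F') {p : V}
    (hp : p ∈ core F) (hp' : p ∈ core F') : F = F' :=
  Subset.antisymm (face_sub hF hF' hp hp'.1) (face_sub hF' hF hp' hp.1)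

theorem uniq_aux {μ : V} {F : Set V} (hF : IsFaceOf (S.orbitHull μ) F) {x : V} (hx : x ∈ core F)
    (hxC : x ∈ S.chamber) : ∀ n : ℕ, ∀ w ∈ S.W, S.len w = n → ∀ y ∈ S.chamber, w y ∈ core F →
    (fun x => w x) '' F = F := by
  intro n
  induction n using Nat.strong_induction_on with
  | _ n ih =>
  intro w hw hn y hy hwy
  by_cases h1 : w = 1
  · subst h1; simp
  obtain ⟨i, w', hw', hww', hlt⟩ := exists_peel S hw h1
  have hpos := key_pos S _ w' hw' rfl i (by rw [← hww']; exact hlt.le) y hy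
  have hneg : S.coroot i (w y) ≤ 0 := by
    rw [hww', LinearEquiv.mul_apply, coroot_s]; linarith
  have hxi := hxC i
  obtain ⟨p, hp, hpi⟩ : ∃ p ∈ core F, S.coroot i p = 0 := by
    by_cases h0 : S.coroot i x = 0
    · exact ⟨x, hx, h0⟩
    have hxp : 0 < S.coroot i x := lt_of_le_of_ne hxi (Ne.symm h0)
    have hd : 0 < S.coroot i x - S.coroot i (w y) := by linarith
    refine ⟨_, core_convex hF.1 hx hwy
      (a := -S.coroot i (w y) / (S.coroot i x - S.coroot i (w y)))
      (b := S.coroot i x / (S.coroot i x - S.coroot i (w y)))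
      (div_nonneg (by linarith) hd.le) (div_nonneg hxi hd.le) (by field_simp; ring), ?_⟩
    simp only [map_add, map_smul, smul_eq_mul]
    field_simp; ring
  have hsp : S.s i p = p := by rw [s_apply, hpi]; simp
  have hsF : (fun x => S.s i x) '' F = F := by
    refine face_eq (face_image S hF (s_mem S i)) hF (p := p) ?_ hp
    have := core_image (g := S.s i) hp
    rwa [hsp] at this
  have hw'y : w' y ∈ core F := by
    have := core_image (g := S.s i) hwy
    rwa [hsF, hww', LinearEquiv.mul_apply, s_s] at this
  have hI := ih _ (by omega) w' hw' rfl y hy hw'y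
  have : (fun x => w x) '' F = (fun x => S.s i x) '' ((fun x => w' x) '' F) := by
    rw [Set.image_image, hww']; rfl
  rw [this, hI, hsF]

theorem main (μ : V) (hμ : μ ∈ S.chamber)
    (F : Set V) (hF : IsFaceOf (S.orbitHull μ) F) :
    (∃ w ∈ S.W, S.IsFundFace μ ((fun x => w x) '' F)) ∧
    (∀ w ∈ S.W, ∀ w' ∈ S.W,
      S.IsFundFace μ ((fun x => w x) '' F) → S.IsFundFace μ ((fun x => w' x) '' F) →
      (fun x => w x) '' F = (fun x => w' x) '' F) := by
  haveI := S.finDim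
  constructor
  · rcases F.eq_empty_or_nonempty with rfl | hne
    · exact ⟨1, one_mem _, face_image S hF (one_mem _), Or.inl (by simp)⟩
    obtain ⟨p, hp⟩ := hne.intrinsicInterior hF.1
    obtain ⟨w, hw, c, hc, hpc⟩ := hull_sub_tits S hμ (hF.2.subset (intrinsicInterior_subset hp))
    refine ⟨w⁻¹, inv_mem hw, face_image S hF (inv_mem hw), Or.inr ⟨c, ?_, hc⟩⟩
    have := AffineEquiv.intrinsicInterior_image (𝕜 := ℝ) (w⁻¹ : V ≃ₗ[ℝ] V).toAffineEquiv F
    change c ∈ intrinsicInterior ℝ ((w⁻¹ : V ≃ₗ[ℝ] V).toAffineEquiv '' F)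
    rw [this]
    refine ⟨p, hp, ?_⟩
    rw [hpc]
    exact inv_app w c
  · intro w hw w' hw' h h'
    rcases F.eq_empty_or_nonempty with rfl | hne
    · simp
    obtain ⟨hf, h⟩ := h
    obtain ⟨hf', h'⟩ := h'
    obtain ⟨x, hx, hxC⟩ := h.resolve_left (hne.image _).ne_empty
    obtain ⟨y, hy, hyC⟩ := h'.resolve_left (hne.image _).ne_empty
    have e : (fun x => (w * w'⁻¹) x) '' ((fun x => w' x) '' F) = (fun x => w x) '' F := by
      rw [Set.image_image]
      apply Set.image_congr
      intro a _
      rw [LinearEquiv.mul_apply, inv_app]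
    have hy2 := core_image (g := w * w'⁻¹) (ri_sub_core _ hy)
    rw [e] at hy2
    have := uniq_aux S hf (ri_sub_core _ hx) hxC _ (w * w'⁻¹) (mul_mem hw (inv_mem hw')) rfl y hyC
      hy2
    rw [← e] at this
    have hinj : Function.Injective (fun x => (w * w'⁻¹) x) := (w * w'⁻¹).injective
    rw [← e]
    exact hinj.image_injective this

end Sub14

open GCMRealization in
theorem statement_14 {m : ℕ} {V : Type*} [NormedAddCommGroup V] [NormedSpace ℝ V]
    (S : GCMRealization m V) (μ : V) (hμ : μ ∈ S.chamber)
    (F : Set V) (hF : IsFaceOf (S.orbitHull μ) F) :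
    (∃ w ∈ S.W, S.IsFundFace μ ((fun x => w x) '' F)) ∧
    (∀ w ∈ S.W, ∀ w' ∈ S.W,
      S.IsFundFace μ ((fun x => w x) '' F) → S.IsFundFace μ ((fun x => w' x) '' F) →
      (fun x => w x) '' F = (fun x => w' x) '' F) := by
  exact Sub14.main S μ hμ F hF
end
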